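/- arXiv:1207.5554 — 2 statements merged into one kernel-verified Lean document; each statement's English description precedes it below -/
import Mathlib

section
/- Let f : X → [0, b] be measurable, let x₁,…,xₙ be a time-homogeneous Markov chain on X, let Γₙ be the dependence matrix of the chain, and set z = (1/n)·Σ_{i=1}^n f(x_i). Then for every ε ≥ 0: P(z − E[z] ≥ ε) ≤ exp(−ε² n / (2b ‖Γₙ‖² (E[z] + ε))) and P(E[z] − z ≥ ε) ≤ exp(−ε² n / (2b ‖Γₙ‖² E[z])). -/
open MeasureTheory ProbabilityTheory Matrix

noncomputable section

/-- Euclidean (`L²`) norm of a finite-dimensional real vector. -/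
def e2norm {m : Type*} [Fintype m] (v : m → ℝ) : ℝ := Real.sqrt (∑ i, v i ^ 2)

/-- Operator norm of a real matrix (w.r.t. Euclidean norms). -/
def opNorm {m n : Type*} [Fintype m] [Fintype n] (M : Matrix m n ℝ) : ℝ :=
  sSup {r | ∃ v : n → ℝ, e2norm v ≤ 1 ∧ r = e2norm (M.mulVec v)}

/-- Total variation distance between two measures: `sup_A |μ(A) - ν(A)|`. -/
def tvDist {S : Type*} [MeasurableSpace S] (μ ν : Measure S) : ℝ :=
  sSup {r | ∃ A : Set S, MeasurableSet A ∧ r = |(μ A).toReal - (ν A).toReal|}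

/-- The `i`-step transition kernel `T^i`. -/
def kernelIter {S : Type*} [MeasurableSpace S] (T : ProbabilityTheory.Kernel S S) :
    ℕ → ProbabilityTheory.Kernel S S
  | 0 => ProbabilityTheory.Kernel.id
  | (i + 1) => T ∘ₖ kernelIter T i

/-- The dependence matrix `Γₙ` of a Markov transition kernel:
`γ_{ij}² = sup_{x,y} ‖T^{j-i}(·|x) - T^{j-i}(·|y)‖_TV` for `i < j`, `γ_{ii} = 1`,
and `γ_{ij} = 0` for `i > j`. -/
def depMatrix {S : Type*} [MeasurableSpace S] (T : ProbabilityTheory.Kernel S S) (n : ℕ) :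
    Matrix (Fin n) (Fin n) ℝ :=
  Matrix.of fun i j =>
    if i = j then 1
    else if i < j then
      Real.sqrt (sSup {r | ∃ p : S × S,
        r = tvDist (kernelIter T ((j : ℕ) - (i : ℕ)) p.1) (kernelIter T ((j : ℕ) - (i : ℕ)) p.2)})
    else 0

/-- σ-algebra generated by `x 0, …, x t`. -/
def pastFiltration {Ω S : Type*} [MeasurableSpace S] (x : ℕ → Ω → S) (t : ℕ) :
    MeasurableSpace Ω :=
  MeasurableSpace.comap (fun ω => fun i : Fin (t + 1) => x i ω) inferInstance

/-- `x 0, …, x (n-1)` is a time-homogeneous Markov chain with transition kernel `T`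
under `P`: the states are measurable and the conditional law of `x (t+1)` given the
past is `T (x t ·)`. -/
def IsMarkovChain {Ω S : Type*} [MeasurableSpace Ω] [MeasurableSpace S]
    (P : Measure Ω) (T : ProbabilityTheory.Kernel S S) (x : ℕ → Ω → S) (n : ℕ) : Prop :=
  (∀ t, t < n → Measurable (x t)) ∧
  ∀ t, t + 1 < n → ∀ A : Set S, MeasurableSet A →
    (P[fun ω => A.indicator (fun _ => (1 : ℝ)) (x (t + 1) ω) | pastFiltration x t])
      =ᵐ[P] fun ω => (T (x t ω) A).toReal

theorem integrable_of_measurable_of_abs_le {α : Type*} [MeasurableSpace α] {μ : Measure α}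
    [IsFiniteMeasure μ] {f : α → ℝ} (hf : Measurable f) {B : ℝ} (hB : ∀ a, |f a| ≤ B) :
    Integrable f μ :=
  Integrable.of_bound hf.aestronglyMeasurable B (ae_of_all _ hB)

theorem integral_mul_le_sqrt_mul_sqrt {α : Type*} [MeasurableSpace α] {μ : Measure α}
    [IsFiniteMeasure μ] {u v : α → ℝ} (hu : Measurable u) (hv : Measurable v)
    (hu0 : ∀ a, 0 ≤ u a) (hv0 : ∀ a, 0 ≤ v a) {B C : ℝ} (huB : ∀ a, u a ≤ B)
    (hvC : ∀ a, v a ≤ C) :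
    ∫ a, u a * v a ∂μ ≤ √(∫ a, u a ^ 2 ∂μ) * √(∫ a, v a ^ 2 ∂μ) := by
  have h := integral_mul_le_Lp_mul_Lq_of_nonneg (μ := μ) Real.HolderConjugate.two_two
    (ae_of_all _ hu0) (ae_of_all _ hv0)
    (MemLp.of_bound hu.aestronglyMeasurable B (ae_of_all _ fun a => by
      rw [Real.norm_of_nonneg (hu0 a)]; exact huB a))
    (MemLp.of_bound hv.aestronglyMeasurable C (ae_of_all _ fun a => by
      rw [Real.norm_of_nonneg (hv0 a)]; exact hvC a))
  simpa only [Real.sqrt_eq_rpow, Real.rpow_two] using h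

/-- Every test function `0 ≤ f` satisfies `∫ f dν - ∫ f dμ ≤ C ‖f‖_{L²(ν)}`. For probability
measures this is dual to `∫ (1 - dμ/dν)₊² dν ≤ C²`. -/
def TransportBound {S : Type*} [MeasurableSpace S] (μ ν : Measure S) (C : ℝ) : Prop :=
  ∀ f : S → ℝ, Measurable f → (∀ s, 0 ≤ f s) → ∀ B : ℝ, (∀ s, f s ≤ B) →
    ∫ s, f s ∂ν - ∫ s, f s ∂μ ≤ C * √(∫ s, f s ^ 2 ∂ν)

theorem exists_meet_density {S : Type*} [MeasurableSpace S] (μ ν : Measure S)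
    [IsFiniteMeasure μ] [IsFiniteMeasure ν] :
    ∃ A : Set S, MeasurableSet A ∧ μ.restrict A ≤ ν.restrict A ∧
      ∃ u : S → ℝ, Measurable u ∧ (∀ s, 0 ≤ u s) ∧ (∀ s, u s ≤ 1) ∧
        ∀ f : S → ℝ, Measurable f → ∀ B : ℝ, (∀ s, |f s| ≤ B) →
          ∫ s, u s * f s ∂μ = ∫ s in A, f s ∂μ + ∫ s in Aᶜ, f s ∂ν := by
  obtain ⟨A, hA⟩ := exists_isHahnDecomposition μ ν
  set κ : Measure S := μ.restrict A + ν.restrict Aᶜ with hκ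
  have hκμ : κ ≤ μ := by
    calc κ ≤ μ.restrict A + μ.restrict Aᶜ := by
            rw [hκ]; exact add_le_add le_rfl hA.ge_on_compl
      _ = μ := Measure.restrict_add_restrict_compl hA.measurableSet
  have hac : κ ≪ μ := Measure.absolutelyContinuous_of_le hκμ
  have hone := Measure.rnDeriv_le_one_of_le hκμ
  refine ⟨A, hA.measurableSet, hA.le_on, fun s => min 1 (κ.rnDeriv μ s).toReal,
    measurable_const.min (Measure.measurable_rnDeriv κ μ).ennreal_toReal,
    fun s => le_min zero_le_one ENNReal.toReal_nonneg, fun s => min_le_left _ _, ?_⟩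
  intro f hf B hB
  have h1 : ∫ s, min 1 (κ.rnDeriv μ s).toReal * f s ∂μ = ∫ s, f s ∂κ := by
    rw [← Measure.withDensity_rnDeriv_eq κ μ hac,
      integral_withDensity_eq_integral_toReal_smul (Measure.measurable_rnDeriv κ μ)
        (Measure.rnDeriv_lt_top κ μ)]
    refine integral_congr_ae ?_
    rw [Measure.withDensity_rnDeriv_eq κ μ hac]
    filter_upwards [hone] with s hs
    have : (κ.rnDeriv μ s).toReal ≤ 1 :=
      ENNReal.toReal_le_of_le_ofReal zero_le_one (by simpa using hs)
    simp [min_eq_right this]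
  rw [h1, hκ, integral_add_measure]
  · exact integrable_of_measurable_of_abs_le hf hB
  · exact integrable_of_measurable_of_abs_le hf hB

theorem TransportBound.trans {S : Type*} [MeasurableSpace S] {μ ν ρ : Measure S}
    [IsFiniteMeasure μ] [IsFiniteMeasure ν] [IsFiniteMeasure ρ] {C D : ℝ} (hC0 : 0 ≤ C)
    (hD0 : 0 ≤ D) (hC : TransportBound μ ν C) (hD : TransportBound ν ρ D) :
    TransportBound μ ρ (C + D) := by
  intro f hf hf0 B hB
  obtain ⟨A, hA, hle, u, hu, hu0, hu1, hint⟩ := exists_meet_density ν ρ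
  have habs : ∀ s, |f s| ≤ B := fun s => by rw [abs_of_nonneg (hf0 s)]; exact hB s
  have hB2 : ∀ s, |f s ^ 2| ≤ B ^ 2 := fun s => by
    rw [abs_pow]; exact pow_le_pow_left₀ (abs_nonneg _) (habs s) 2
  have huf0 : ∀ s, 0 ≤ u s * f s := fun s => mul_nonneg (hu0 s) (hf0 s)
  have hufB : ∀ s, u s * f s ≤ f s := fun s => mul_le_of_le_one_left (hf0 s) (hu1 s)
  have hI : ∀ (m : Measure S) [IsFiniteMeasure m], Integrable f m := fun m _ =>
    integrable_of_measurable_of_abs_le hf habs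
  have hI2 : ∀ (m : Measure S) [IsFiniteMeasure m], Integrable (fun s => f s ^ 2) m := fun m _ =>
    integrable_of_measurable_of_abs_le (hf.pow_const 2) hB2
  have h1 := hC (fun s => u s * f s) (hu.mul hf) huf0 B fun s => (hufB s).trans (hB s)
  have h2 := hD (A.indicator f) (hf.indicator hA) (Set.indicator_nonneg fun s _ => hf0 s) B
    fun s => (Set.indicator_le_self' (fun s _ => hf0 s) s).trans (hB s)
  have h3 : ∫ s, u s * f s ∂μ ≤ ∫ s, f s ∂μ :=
    integral_mono (integrable_of_measurable_of_abs_le (hu.mul hf) (B := B) fun s => by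
      rw [abs_of_nonneg (huf0 s)]; exact (hufB s).trans (hB s)) (hI μ) hufB
  have h4 : ∫ s, (u s * f s) ^ 2 ∂ν ≤ ∫ s, f s ^ 2 ∂ρ := by
    calc ∫ s, (u s * f s) ^ 2 ∂ν ≤ ∫ s, u s * f s ^ 2 ∂ν := by
          have hle' : ∀ s, (u s * f s) ^ 2 ≤ u s * f s ^ 2 := fun s => by
            rw [mul_pow]
            exact mul_le_mul_of_nonneg_right (by nlinarith [hu0 s, hu1 s]) (sq_nonneg _)
          have hb : ∀ s, |u s * f s ^ 2| ≤ B ^ 2 := fun s => by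
            rw [abs_mul, abs_of_nonneg (hu0 s)]
            exact (mul_le_of_le_one_left (abs_nonneg _) (hu1 s)).trans (hB2 s)
          refine integral_mono (integrable_of_measurable_of_abs_le ((hu.mul hf).pow_const 2)
            (B := B ^ 2) fun s => ?_)
            (integrable_of_measurable_of_abs_le (hu.mul (hf.pow_const 2)) hb) hle'
          exact (abs_of_nonneg (sq_nonneg (u s * f s))).le.trans
            ((hle' s).trans ((le_abs_self _).trans (hb s)))
      _ = ∫ s in A, f s ^ 2 ∂ν + ∫ s in Aᶜ, f s ^ 2 ∂ρ := hint _ (hf.pow_const 2) _ hB2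
      _ ≤ ∫ s in A, f s ^ 2 ∂ρ + ∫ s in Aᶜ, f s ^ 2 ∂ρ := by
          gcongr ?_ + _
          exact integral_mono_measure hle (ae_of_all _ fun s => sq_nonneg _) (hI2 _)
      _ = ∫ s, f s ^ 2 ∂ρ := integral_add_compl hA (hI2 ρ)
  have h5 : ∫ s, (A.indicator f s) ^ 2 ∂ρ ≤ ∫ s, f s ^ 2 ∂ρ := by
    have e : ∀ s, (A.indicator f s) ^ 2 = A.indicator (fun s => f s ^ 2) s := fun s => by
      by_cases h : s ∈ A <;> simp [h]
    simp_rw [e]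
    rw [integral_indicator hA]
    exact setIntegral_le_integral (hI2 ρ) (ae_of_all _ fun s => sq_nonneg _)
  rw [integral_indicator hA, integral_indicator hA] at h2
  have h6 := hint f hf B habs
  have h7 := integral_add_compl hA (hI ρ)
  have h8 := mul_le_mul_of_nonneg_left (Real.sqrt_le_sqrt h4) hC0
  have h9 := mul_le_mul_of_nonneg_left (Real.sqrt_le_sqrt h5) hD0
  rw [add_mul]
  linarith

theorem transportBound_dirac {S : Type*} [MeasurableSpace S] (a b : S) :
    TransportBound (Measure.dirac a) (Measure.dirac b) 1 := by
  intro f hf hf0 B hB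
  rw [integral_dirac' _ _ hf.stronglyMeasurable, integral_dirac' _ _ hf.stronglyMeasurable,
    integral_dirac' _ _ (hf.pow_const 2).stronglyMeasurable, Real.sqrt_sq (hf0 b)]
  linarith [hf0 a]

theorem transportBound_of_abs_sub_le {S : Type*} [MeasurableSpace S] (μ ν : Measure S)
    [IsProbabilityMeasure μ] [IsProbabilityMeasure ν] {c : ℝ}
    (hc : ∀ A : Set S, MeasurableSet A → |(ν A).toReal - (μ A).toReal| ≤ c) :
    TransportBound μ ν √c := by
  intro f hf hf0 B hB
  obtain ⟨A, hA, hle, u, hu, hu0, hu1, hint⟩ := exists_meet_density ν μ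
  have habs : ∀ s, |f s| ≤ B := fun s => by rw [abs_of_nonneg (hf0 s)]; exact hB s
  have hI : ∀ (m : Measure S) [IsFiniteMeasure m], Integrable f m := fun m _ =>
    integrable_of_measurable_of_abs_le hf habs
  have hv0 : ∀ s, 0 ≤ 1 - u s := fun s => sub_nonneg.2 (hu1 s)
  have hv1 : ∀ s, 1 - u s ≤ 1 := fun s => by linarith [hu0 s]
  have hvm : Measurable fun s => 1 - u s := measurable_const.sub hu
  have hIu : Integrable u ν := integrable_of_measurable_of_abs_le hu (B := 1) fun s => by
    rw [abs_of_nonneg (hu0 s)]; exact hu1 s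
  have h1 := integral_mul_le_sqrt_mul_sqrt (μ := ν) hvm hf hv0 hf0 hv1 hB
  have h2 : ∫ s, (1 - u s) ^ 2 ∂ν ≤ c := by
    calc ∫ s, (1 - u s) ^ 2 ∂ν ≤ ∫ s, (1 - u s) ∂ν := by
          refine integral_mono (integrable_of_measurable_of_abs_le (hvm.pow_const 2) (B := 1)
            fun s => ?_) ((integrable_const 1).sub hIu) fun s => ?_
          · rw [abs_of_nonneg (sq_nonneg _)]; exact pow_le_one₀ (hv0 s) (hv1 s)
          · show (1 - u s) ^ 2 ≤ 1 - u s
            nlinarith [hv0 s, hv1 s]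
      _ = (ν Aᶜ).toReal - (μ Aᶜ).toReal := by
          have h := hint (fun _ => 1) measurable_const 1 (by simp)
          simp only [mul_one] at h
          rw [integral_sub (integrable_const 1) hIu, h]
          have h' := measureReal_add_measureReal_compl (μ := ν) hA
          simp [Measure.real] at h' ⊢
          linarith
      _ ≤ c := (le_abs_self _).trans (hc _ hA.compl)
  have h3 : ∫ s, (1 - u s) * f s ∂ν = ∫ s, f s ∂ν - ∫ s, u s * f s ∂ν := by
    rw [← integral_sub (hI ν)]
    · congr 1; ext s; ring
    · exact integrable_of_measurable_of_abs_le (hu.mul hf) (B := B) fun s => by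
        rw [abs_mul, abs_of_nonneg (hu0 s)]
        exact (mul_le_of_le_one_left (abs_nonneg _) (hu1 s)).trans (habs s)
  have h4 : ∫ s, u s * f s ∂ν ≤ ∫ s, f s ∂μ := by
    rw [hint f hf B habs, ← integral_add_compl hA (hI μ)]
    gcongr ?_ + _
    exact integral_mono_measure hle (ae_of_all _ hf0) (hI _)
  have h5 := mul_le_mul_of_nonneg_right (Real.sqrt_le_sqrt h2) (Real.sqrt_nonneg (∫ s, f s ^ 2 ∂ν))
  linarith

/-- The law of `X` under the measure with density `g` with respect to `P`. -/
def tiltedLaw {Ω S : Type*} [MeasurableSpace Ω] [MeasurableSpace S] (P : Measure Ω) (g : Ω → ℝ)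
    (X : Ω → S) : Measure S :=
  (P.withDensity fun ω => ENNReal.ofReal (g ω)).map X

section TiltedLaw

variable {Ω S : Type*} [MeasurableSpace Ω] [MeasurableSpace S] {P : Measure Ω}

theorem isFiniteMeasure_tiltedLaw [IsFiniteMeasure P] {g : Ω → ℝ} (hg : Measurable g) {M : ℝ}
    (hM : ∀ ω, |g ω| ≤ M) (X : Ω → S) : IsFiniteMeasure (tiltedLaw P g X) := by
  have : IsFiniteMeasure (P.withDensity fun ω => ENNReal.ofReal (g ω)) :=
    isFiniteMeasure_withDensity_ofReal (integrable_of_measurable_of_abs_le hg hM).2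
  unfold tiltedLaw
  infer_instance

theorem tiltedLaw_one (X : Ω → S) : tiltedLaw P (fun _ => 1) X = P.map X := by
  simp [tiltedLaw]

theorem integral_tiltedLaw {g : Ω → ℝ} (hg : Measurable g) (hg0 : ∀ ω, 0 ≤ g ω)
    {X : Ω → S} (hX : Measurable X) {f : S → ℝ} (hf : Measurable f) :
    ∫ s, f s ∂(tiltedLaw P g X) = ∫ ω, g ω * f (X ω) ∂P := by
  rw [tiltedLaw, integral_map hX.aemeasurable hf.aestronglyMeasurable,
    integral_withDensity_eq_integral_toReal_smul hg.ennreal_ofReal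
      (ae_of_all _ fun _ => ENNReal.ofReal_lt_top)]
  simp [ENNReal.toReal_ofReal (hg0 _)]

theorem integral_kernel_comp_measure {μ : Measure S} [IsFiniteMeasure μ] (K : Kernel S S)
    [IsMarkovKernel K] {f : S → ℝ} (hf : Measurable f) {B : ℝ} (hB : ∀ s, |f s| ≤ B) :
    ∫ s, f s ∂(K ∘ₘ μ) = ∫ s, ∫ y, f y ∂(K s) ∂μ := by
  rw [← Measure.snd_compProd, Measure.snd,
    integral_map measurable_snd.aemeasurable hf.aestronglyMeasurable, Measure.integral_compProd]
  exact integrable_of_measurable_of_abs_le (hf.comp measurable_snd) fun p => hB p.2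

theorem integral_kernel_comp_tiltedLaw [IsFiniteMeasure P] {g : Ω → ℝ} (hg : Measurable g)
    (hg0 : ∀ ω, 0 ≤ g ω) {M : ℝ} (hM : ∀ ω, g ω ≤ M) {X : Ω → S} (hX : Measurable X)
    (K : Kernel S S) [IsMarkovKernel K] {f : S → ℝ} (hf : Measurable f) {B : ℝ}
    (hB : ∀ s, |f s| ≤ B) :
    ∫ s, f s ∂(K ∘ₘ tiltedLaw P g X) = ∫ ω, g ω * ∫ y, f y ∂(K (X ω)) ∂P := by
  have := isFiniteMeasure_tiltedLaw (P := P) hg (M := M)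
    (fun ω => by rw [abs_of_nonneg (hg0 ω)]; exact hM ω) X
  rw [integral_kernel_comp_measure K hf hB,
    integral_tiltedLaw hg hg0 hX hf.stronglyMeasurable.integral_kernel.measurable]

theorem transportBound_kernel_comp_tiltedLaw [IsProbabilityMeasure P] {X : Ω → S}
    (hX : Measurable X) (K : Kernel S S) [IsMarkovKernel K] {γ : ℝ} (hγ : 0 ≤ γ)
    (hK : ∀ a b, TransportBound (K a) (K b) γ) {c M : ℝ} (hc : 0 < c) {g g' : Ω → ℝ}
    (hg : Measurable g) (hg' : Measurable g') (hgI : ∀ ω, g ω ∈ Set.Icc c M)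
    (hgI' : ∀ ω, g' ω ∈ Set.Icc c M) (hint : ∫ ω, g ω ∂P = ∫ ω, g' ω ∂P) :
    TransportBound (K ∘ₘ tiltedLaw P g' X) (K ∘ₘ tiltedLaw P g X)
      (γ * √(∫ ω, max (g ω - g' ω) 0 ^ 2 / g ω ∂P)) := by
  intro f hf hf0 B hB
  have : Nonempty Ω := P.nonempty_of_neZero
  have : Nonempty S := this.map X
  have hg0 : ∀ ω, 0 < g ω := fun ω => hc.trans_le (hgI ω).1
  have hg0' : ∀ ω, 0 < g' ω := fun ω => hc.trans_le (hgI' ω).1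
  have habs : ∀ s, |f s| ≤ B := fun s => by rw [abs_of_nonneg (hf0 s)]; exact hB s
  have hB0 : 0 ≤ B := (abs_nonneg _).trans (habs (Classical.arbitrary S))
  have hB2 : ∀ s, |f s ^ 2| ≤ B ^ 2 := fun s => by
    rw [abs_pow]; exact pow_le_pow_left₀ (abs_nonneg _) (habs s) 2
  rw [integral_kernel_comp_tiltedLaw hg (fun ω => (hg0 ω).le) (fun ω => (hgI ω).2) hX K hf habs,
    integral_kernel_comp_tiltedLaw hg' (fun ω => (hg0' ω).le) (fun ω => (hgI' ω).2) hX K hf habs,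
    integral_kernel_comp_tiltedLaw hg (fun ω => (hg0 ω).le) (fun ω => (hgI ω).2) hX K
      (hf.pow_const 2) hB2]
  set h : S → ℝ := fun y => ∫ s, f s ∂(K y) with hh
  set q : S → ℝ := fun y => ∫ s, f s ^ 2 ∂(K y) with hq
  have hhm : Measurable h := hf.stronglyMeasurable.integral_kernel.measurable
  have hqm : Measurable q := (hf.pow_const 2).stronglyMeasurable.integral_kernel.measurable
  have hh0 : ∀ y, 0 ≤ h y := fun y => integral_nonneg hf0
  have hhB : ∀ y, h y ≤ B := fun y => by
    have := integral_mono (μ := K y) (integrable_of_measurable_of_abs_le hf habs)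
      (integrable_const B) hB
    simpa using this
  have hq0 : ∀ y, 0 ≤ q y := fun y => integral_nonneg fun s => sq_nonneg _
  have hqB : ∀ y, q y ≤ B ^ 2 := fun y => by
    have := integral_mono (μ := K y) (integrable_of_measurable_of_abs_le (hf.pow_const 2) hB2)
      (integrable_const (B ^ 2)) fun s => (le_abs_self _).trans (hB2 s)
    simpa using this
  set ι : ℝ := ⨅ y, h y with hι
  have hιle : ∀ y, ι ≤ h y := fun y => ciInf_le ⟨0, by rintro _ ⟨y, rfl⟩; exact hh0 y⟩ y
  have hιge : ∀ y, h y - ι ≤ γ * √(q y) := fun y => by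
    have : h y - γ * √(q y) ≤ ι := le_ciInf fun y' => by
      have := hK y' y f hf hf0 B hB
      simp only [hh, hq]
      linarith
    linarith
  have hgM : ∀ ω, |g ω| ≤ M := fun ω => by rw [abs_of_pos (hg0 ω)]; exact (hgI ω).2
  have hgM' : ∀ ω, |g' ω| ≤ M := fun ω => by rw [abs_of_pos (hg0' ω)]; exact (hgI' ω).2
  have hgi : Integrable g P := integrable_of_measurable_of_abs_le hg hgM
  have hgi' : Integrable g' P := integrable_of_measurable_of_abs_le hg' hgM'
  have hM0 : 0 ≤ M := (abs_nonneg _).trans (hgM (Classical.arbitrary Ω))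
  have hmul : ∀ k : Ω → ℝ, Measurable k → (∀ ω, |k ω| ≤ M) →
      Integrable (fun ω => k ω * h (X ω)) P := fun k hk hkM =>
    integrable_of_measurable_of_abs_le (hk.mul (hhm.comp hX)) (B := M * B) fun ω => by
      rw [abs_mul, abs_of_nonneg (hh0 _)]
      exact mul_le_mul (hkM ω) (hhB _) (hh0 _) hM0
  set p : Ω → ℝ := fun ω => max (g ω - g' ω) 0 with hp
  have hp0 : ∀ ω, 0 ≤ p ω := fun ω => le_max_right _ _
  have hpM : ∀ ω, p ω ≤ M := fun ω =>
    max_le (by linarith [(hgI ω).2, (hg0' ω)]) hM0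
  have hpm : Measurable p := (hg.sub hg').max measurable_const
  have hsc : ∀ ω, √c ≤ √(g ω) := fun ω => Real.sqrt_le_sqrt (hgI ω).1
  have hc' : 0 < √c := Real.sqrt_pos.2 hc
  have hum : Measurable fun ω => p ω / √(g ω) := hpm.div hg.sqrt
  have hvm : Measurable fun ω => √(g ω) * √(q (X ω)) := hg.sqrt.mul (hqm.comp hX).sqrt
  have hu0 : ∀ ω, 0 ≤ p ω / √(g ω) := fun ω => div_nonneg (hp0 ω) (Real.sqrt_nonneg _)
  have hv0 : ∀ ω, 0 ≤ √(g ω) * √(q (X ω)) := fun ω => by positivity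
  have huB : ∀ ω, p ω / √(g ω) ≤ M / √c := fun ω =>
    div_le_div₀ hM0 (hpM ω) hc' (hsc ω)
  have hvB : ∀ ω, √(g ω) * √(q (X ω)) ≤ √M * √(B ^ 2) := fun ω =>
    mul_le_mul (Real.sqrt_le_sqrt (hgI ω).2) (Real.sqrt_le_sqrt (hqB _)) (Real.sqrt_nonneg _)
      (Real.sqrt_nonneg _)
  have hcs := integral_mul_le_sqrt_mul_sqrt (μ := P) hum hvm hu0 hv0 huB hvB
  have e1 : ∀ ω, (p ω / √(g ω)) ^ 2 = p ω ^ 2 / g ω := fun ω => by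
    rw [div_pow, Real.sq_sqrt (hg0 ω).le]
  have e2 : ∀ ω, (√(g ω) * √(q (X ω))) ^ 2 = g ω * q (X ω) := fun ω => by
    rw [mul_pow, Real.sq_sqrt (hg0 ω).le, Real.sq_sqrt (hq0 _)]
  simp only [e1, e2] at hcs
  calc ∫ ω, g ω * h (X ω) ∂P - ∫ ω, g' ω * h (X ω) ∂P
      = ∫ ω, (g ω * h (X ω) - g' ω * h (X ω) - ι * (g ω - g' ω)) ∂P := by
        rw [integral_sub, integral_sub (hmul g hg hgM) (hmul g' hg' hgM'), integral_const_mul,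
          integral_sub hgi hgi', hint]
        · ring
        · exact (hmul g hg hgM).sub (hmul g' hg' hgM')
        · exact (hgi.sub hgi').const_mul ι
    _ ≤ ∫ ω, γ * (p ω / √(g ω) * (√(g ω) * √(q (X ω)))) ∂P := by
        refine integral_mono (((hmul g hg hgM).sub (hmul g' hg' hgM')).sub
          ((hgi.sub hgi').const_mul ι)) (Integrable.const_mul
          (integrable_of_measurable_of_abs_le (hum.mul hvm) (B := M / √c * (√M * √(B ^ 2)))
            fun ω => ?_) γ) fun ω => ?_
        · rw [Pi.mul_apply, abs_of_nonneg (mul_nonneg (hu0 ω) (hv0 ω))]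
          exact mul_le_mul (huB ω) (hvB ω) (hv0 ω) (by positivity)
        · have h1 : p ω / √(g ω) * (√(g ω) * √(q (X ω))) = p ω * √(q (X ω)) := by
            have := (Real.sqrt_pos.2 (hg0 ω)).ne'
            field_simp
          show g ω * h (X ω) - g' ω * h (X ω) - ι * (g ω - g' ω) ≤ _
          rw [h1]
          calc g ω * h (X ω) - g' ω * h (X ω) - ι * (g ω - g' ω)
              = (g ω - g' ω) * (h (X ω) - ι) := by ring
            _ ≤ p ω * (h (X ω) - ι) :=
                mul_le_mul_of_nonneg_right (le_max_left _ _) (sub_nonneg.2 (hιle _))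
            _ ≤ p ω * (γ * √(q (X ω))) := mul_le_mul_of_nonneg_left (hιge _) (hp0 ω)
            _ = γ * (p ω * √(q (X ω))) := by ring
    _ ≤ γ * (√(∫ ω, p ω ^ 2 / g ω ∂P) * √(∫ ω, g ω * q (X ω) ∂P)) := by
        rw [integral_const_mul]
        exact mul_le_mul_of_nonneg_left hcs hγ
    _ = _ := by ring

end TiltedLaw

theorem exists_bounded_condExp {Ω : Type*} {m m0 : MeasurableSpace Ω} (hm : m ≤ m0)
    (P : Measure Ω) [IsProbabilityMeasure P] {g : Ω → ℝ} (hg : Measurable g) {c M : ℝ}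
    (hgI : ∀ ω, g ω ∈ Set.Icc c M) :
    ∃ G : Ω → ℝ, Measurable[m] G ∧ (∀ ω, G ω ∈ Set.Icc c M) ∧
      ∀ w : Ω → ℝ, Measurable[m] w → ∀ B : ℝ, (∀ ω, |w ω| ≤ B) →
        ∫ ω, w ω * g ω ∂P = ∫ ω, w ω * G ω ∂P := by
  have : Nonempty Ω := P.nonempty_of_neZero
  have hcM : c ≤ M := (hgI (Classical.arbitrary Ω)).1.trans (hgI _).2
  have hgi : Integrable g P := integrable_of_measurable_of_abs_le hg (B := max |c| |M|) fun ω =>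
    abs_le_max_abs_abs (hgI ω).1 (hgI ω).2
  have hlow : ∀ᵐ ω ∂P, c ≤ (P[g | m]) ω := by
    have h := condExp_mono (m := m) (integrable_const c) hgi (ae_of_all P fun ω => (hgI ω).1)
    rwa [condExp_const hm] at h
  have hupp : ∀ᵐ ω ∂P, (P[g | m]) ω ≤ M := by
    have h := condExp_mono (m := m) hgi (integrable_const M) (ae_of_all P fun ω => (hgI ω).2)
    rwa [condExp_const hm] at h
  refine ⟨fun ω => max c (min M ((P[g | m]) ω)),
    measurable_const.max (measurable_const.min stronglyMeasurable_condExp.measurable),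
    fun ω => ⟨le_max_left _ _, max_le hcM (min_le_left _ _)⟩, fun w hw B hB => ?_⟩
  have h1 := condExp_stronglyMeasurable_mul_of_bound hm (μ := P) hw.stronglyMeasurable hgi B
    (ae_of_all _ hB)
  calc ∫ ω, w ω * g ω ∂P = ∫ ω, (P[w * g | m]) ω ∂P := (integral_condExp hm).symm
    _ = ∫ ω, w ω * max c (min M ((P[g | m]) ω)) ∂P := by
      refine integral_congr_ae ?_
      filter_upwards [h1, hlow, hupp] with ω h hl hu
      rw [h, Pi.mul_apply, min_eq_right hu, max_eq_right hl]

theorem pastFiltration_le {Ω S : Type*} [m0 : MeasurableSpace Ω] [MeasurableSpace S]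
    {x : ℕ → Ω → S} {t : ℕ} (hx : ∀ i ≤ t, Measurable (x i)) : pastFiltration x t ≤ m0 :=
  Measurable.comap_le (measurable_pi_lambda _ fun i => hx i (Nat.lt_succ_iff.1 i.2))

theorem measurable_pastFiltration {Ω S : Type*} [MeasurableSpace S]
    (x : ℕ → Ω → S) {i t : ℕ} (hi : i ≤ t) : Measurable[pastFiltration x t] (x i) := by
  have h : Measurable[pastFiltration x t] fun ω => fun i : Fin (t + 1) => x i ω :=
    comap_measurable _
  exact (measurable_pi_apply (⟨i, Nat.lt_succ_iff.2 hi⟩ : Fin (t + 1))).comp h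

theorem pastFiltration_mono {Ω S : Type*} [MeasurableSpace S]
    (x : ℕ → Ω → S) {s t : ℕ} (hst : s ≤ t) : pastFiltration x s ≤ pastFiltration x t :=
  Measurable.comap_le (@measurable_pi_lambda _ _ _ (pastFiltration x t) _ _ fun i =>
    measurable_pastFiltration x ((Nat.lt_succ_iff.1 i.2).trans hst))

theorem IsMarkovChain.comp_tiltedLaw {Ω S : Type*} [MeasurableSpace Ω] [MeasurableSpace S]
    {P : Measure Ω} [IsProbabilityMeasure P] {T : Kernel S S} [IsMarkovKernel T]
    {x : ℕ → Ω → S} {n : ℕ} (hx : IsMarkovChain P T x n) {t : ℕ} (ht : t + 1 < n) {w : Ω → ℝ}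
    (hw : Measurable[pastFiltration x t] w) {M : ℝ} (hwM : ∀ ω, w ω ∈ Set.Icc 0 M) :
    T ∘ₘ tiltedLaw P w (x t) = tiltedLaw P w (x (t + 1)) := by
  have hm := pastFiltration_le fun i (hi : i ≤ t) => hx.1 i (by omega)
  have hw' : Measurable w := hw.mono hm le_rfl
  have hxt := hx.1 t (by omega)
  have hxt' := hx.1 (t + 1) ht
  ext A hA
  have hI : Measurable fun ω => A.indicator (fun _ => (1 : ℝ)) (x (t + 1) ω) :=
    (measurable_const.indicator hA).comp hxt'
  have hI1 : ∀ ω, |A.indicator (fun _ => (1 : ℝ)) (x (t + 1) ω)| ≤ 1 := fun ω => by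
    by_cases h : x (t + 1) ω ∈ A <;> simp [h]
  have hwb : ∀ ω, ‖w ω‖ ≤ M := fun ω => by
    rw [Real.norm_of_nonneg (hwM ω).1]; exact (hwM ω).2
  have hII := integrable_of_measurable_of_abs_le (μ := P) hI hI1
  have h1 := condExp_stronglyMeasurable_mul_of_bound hm (μ := P) hw.stronglyMeasurable hII M
    (ae_of_all _ hwb)
  have key : ∫ ω, w ω * A.indicator (fun _ => (1 : ℝ)) (x (t + 1) ω) ∂P =
      ∫ ω, w ω * (T (x t ω) A).toReal ∂P := by
    rw [← integral_condExp (μ := P) (f := fun ω => w ω * A.indicator (fun _ => (1 : ℝ))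
      (x (t + 1) ω)) hm]
    refine integral_congr_ae ?_
    filter_upwards [h1, hx.2 t ht A hA] with ω h h'
    rw [← h', ← Pi.mul_apply, ← h]
    rfl
  have hTA : Measurable fun ω => T (x t ω) A := (T.measurable_coe hA).comp hxt
  have l1 : (T ∘ₘ tiltedLaw P w (x t)) A =
      ENNReal.ofReal (∫ ω, w ω * (T (x t ω) A).toReal ∂P) := by
    rw [Measure.bind_apply hA T.aemeasurable, tiltedLaw, lintegral_map (T.measurable_coe hA) hxt,
      lintegral_withDensity_eq_lintegral_mul _ hw'.ennreal_ofReal hTA,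
      ofReal_integral_eq_lintegral_ofReal]
    · refine lintegral_congr fun ω => ?_
      rw [ENNReal.ofReal_mul (hwM ω).1, ENNReal.ofReal_toReal (measure_ne_top _ _)]
      rfl
    · refine integrable_of_measurable_of_abs_le (hw'.mul hTA.ennreal_toReal) (B := M) fun ω => ?_
      rw [abs_mul, abs_of_nonneg ENNReal.toReal_nonneg]
      exact (mul_le_of_le_one_right (abs_nonneg _) measureReal_le_one).trans (hwb ω)
    · exact ae_of_all _ fun ω => mul_nonneg (hwM ω).1 ENNReal.toReal_nonneg
  have l2 : tiltedLaw P w (x (t + 1)) A =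
      ENNReal.ofReal (∫ ω, w ω * A.indicator (fun _ => (1 : ℝ)) (x (t + 1) ω) ∂P) := by
    rw [tiltedLaw, Measure.map_apply hxt' hA, withDensity_apply _ (hxt' hA),
      ← lintegral_indicator (hxt' hA), ofReal_integral_eq_lintegral_ofReal]
    · refine lintegral_congr fun ω => ?_
      by_cases h : x (t + 1) ω ∈ A <;> simp [h]
    · refine integrable_of_measurable_of_abs_le (hw'.mul hI) (B := M) fun ω => ?_
      rw [abs_mul]
      exact (mul_le_of_le_one_right (abs_nonneg _) (hI1 ω)).trans (hwb ω)
    · refine ae_of_all _ fun ω => mul_nonneg (hwM ω).1 (Set.indicator_nonneg (fun _ _ => ?_) _)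
      exact zero_le_one
  rw [l1, l2, key]

/-- The entry `γ_{kj}` of the dependence matrix, indexed by natural numbers. -/
def depCoeff {S : Type*} [MeasurableSpace S] (T : Kernel S S) (k j : ℕ) : ℝ :=
  if k = j then 1
  else if k < j then
    √(sSup {r | ∃ p : S × S, r = tvDist (kernelIter T (j - k) p.1) (kernelIter T (j - k) p.2)})
  else 0

section DepMatrix

variable {S : Type*} [MeasurableSpace S] (T : Kernel S S)

theorem depMatrix_apply (n : ℕ) (i j : Fin n) : depMatrix T n i j = depCoeff T i j := by
  simp [depMatrix, depCoeff, Fin.ext_iff]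

theorem depCoeff_nonneg (k j : ℕ) : 0 ≤ depCoeff T k j := by
  unfold depCoeff
  split_ifs <;> positivity

theorem depCoeff_eq_zero {k j : ℕ} (h : j < k) : depCoeff T k j = 0 := by
  simp [depCoeff, h.ne', h.not_gt]

instance isMarkovKernel_kernelIter [IsMarkovKernel T] (i : ℕ) :
    IsMarkovKernel (kernelIter T i) := by
  induction i with
  | zero => unfold kernelIter; infer_instance
  | succ i ih => unfold kernelIter; infer_instance

theorem kernelIter_comp_self (i : ℕ) : kernelIter T i ∘ₖ T = T ∘ₖ kernelIter T i := by
  induction i with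
  | zero => simp [kernelIter]
  | succ i ih => rw [kernelIter, Kernel.comp_assoc, ih]

theorem abs_toReal_sub_toReal_le_one (μ ν : Measure S) [IsProbabilityMeasure μ]
    [IsProbabilityMeasure ν] (A : Set S) : |(μ A).toReal - (ν A).toReal| ≤ 1 := by
  have h1 : (μ A).toReal ≤ 1 := measureReal_le_one
  have h2 : (ν A).toReal ≤ 1 := measureReal_le_one
  have h3 : 0 ≤ (μ A).toReal := ENNReal.toReal_nonneg
  have h4 : 0 ≤ (ν A).toReal := ENNReal.toReal_nonneg
  rw [abs_le]
  constructor <;> linarith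

theorem abs_toReal_sub_toReal_le_tvDist (μ ν : Measure S) [IsProbabilityMeasure μ]
    [IsProbabilityMeasure ν] {A : Set S} (hA : MeasurableSet A) :
    |(μ A).toReal - (ν A).toReal| ≤ tvDist μ ν :=
  le_csSup ⟨1, by rintro _ ⟨A, -, rfl⟩; exact abs_toReal_sub_toReal_le_one μ ν A⟩ ⟨A, hA, rfl⟩

theorem tvDist_le_one (μ ν : Measure S) [IsProbabilityMeasure μ] [IsProbabilityMeasure ν] :
    tvDist μ ν ≤ 1 :=
  csSup_le ⟨_, ∅, MeasurableSet.empty, rfl⟩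
    (by rintro _ ⟨A, -, rfl⟩; exact abs_toReal_sub_toReal_le_one μ ν A)

theorem transportBound_kernelIter [IsMarkovKernel T] {k j : ℕ} (hkj : k ≤ j) (a b : S) :
    TransportBound (kernelIter T (j - k) a) (kernelIter T (j - k) b) (depCoeff T k j) := by
  rcases hkj.eq_or_lt with rfl | h
  · simpa [depCoeff, kernelIter, Kernel.id_apply] using transportBound_dirac a b
  · rw [depCoeff, if_neg h.ne, if_pos h]
    refine transportBound_of_abs_sub_le _ _ fun A hA => ?_
    refine (abs_toReal_sub_toReal_le_tvDist _ _ hA).trans (le_csSup ⟨1, ?_⟩ ⟨(b, a), rfl⟩)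
    rintro _ ⟨p, rfl⟩
    exact tvDist_le_one _ _

end DepMatrix

section OpNorm

variable {m n : Type*} [Fintype m] [Fintype n]

theorem e2norm_nonneg (v : n → ℝ) : 0 ≤ e2norm v := Real.sqrt_nonneg _

theorem e2norm_smul (c : ℝ) (v : n → ℝ) : e2norm (c • v) = |c| * e2norm v := by
  simp only [e2norm, Pi.smul_apply, smul_eq_mul, mul_pow, ← Finset.mul_sum]
  rw [Real.sqrt_mul (sq_nonneg c), Real.sqrt_sq_eq_abs]

theorem sum_mul_le_e2norm_mul_e2norm (u v : n → ℝ) : ∑ i, u i * v i ≤ e2norm u * e2norm v :=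
  Real.sum_mul_le_sqrt_mul_sqrt _ _ _

theorem bddAbove_e2norm_mulVec (M : Matrix m n ℝ) :
    BddAbove {r | ∃ v : n → ℝ, e2norm v ≤ 1 ∧ r = e2norm (M.mulVec v)} := by
  refine ⟨√(∑ i, ∑ j, M i j ^ 2), ?_⟩
  rintro _ ⟨v, hv, rfl⟩
  refine Real.sqrt_le_sqrt (Finset.sum_le_sum fun i _ => ?_)
  have hv2 : ∑ j, v j ^ 2 ≤ 1 := Real.sqrt_le_one.1 hv
  calc M.mulVec v i ^ 2 ≤ (∑ j, M i j ^ 2) * ∑ j, v j ^ 2 :=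
        Finset.sum_mul_sq_le_sq_mul_sq _ _ _
    _ ≤ ∑ j, M i j ^ 2 := mul_le_of_le_one_right (Finset.sum_nonneg fun j _ => sq_nonneg _) hv2

theorem e2norm_mulVec_le (M : Matrix m n ℝ) (v : n → ℝ) :
    e2norm (M.mulVec v) ≤ opNorm M * e2norm v := by
  rcases (e2norm_nonneg v).eq_or_lt with h | h
  · have hv : v = 0 := by
      have h0 : ∑ i, v i ^ 2 = 0 :=
        (Real.sqrt_eq_zero (Finset.sum_nonneg fun i _ => sq_nonneg _)).1 h.symm
      funext i
      exact pow_eq_zero_iff two_ne_zero |>.1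
        ((Finset.sum_eq_zero_iff_of_nonneg fun i _ => sq_nonneg _).1 h0 i (Finset.mem_univ i))
    simp [hv, e2norm]
  · have h1 : e2norm (M.mulVec ((e2norm v)⁻¹ • v)) ≤ opNorm M :=
      le_csSup (bddAbove_e2norm_mulVec M) ⟨_, by
        rw [e2norm_smul, abs_of_pos (inv_pos.2 h), inv_mul_cancel₀ h.ne'], rfl⟩
    rw [Matrix.mulVec_smul, e2norm_smul, abs_of_pos (inv_pos.2 h), inv_mul_le_iff₀ h] at h1
    linarith

theorem opNorm_nonneg (M : Matrix m n ℝ) : 0 ≤ opNorm M :=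
  Real.sSup_nonneg (by rintro _ ⟨v, -, rfl⟩; exact e2norm_nonneg _)

theorem sum_sum_mul_le_opNorm (M : Matrix m n ℝ) (u : m → ℝ) (v : n → ℝ) :
    ∑ j, (∑ i, M i j * u i) * v j ≤ opNorm M * e2norm u * e2norm v := by
  calc ∑ j, (∑ i, M i j * u i) * v j = ∑ i, u i * M.mulVec v i := by
        simp only [Matrix.mulVec, dotProduct, Finset.mul_sum, Finset.sum_mul]
        rw [Finset.sum_comm]
        exact Finset.sum_congr rfl fun i _ => Finset.sum_congr rfl fun j _ => by ring
    _ ≤ e2norm u * e2norm (M.mulVec v) := sum_mul_le_e2norm_mul_e2norm _ _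
    _ ≤ e2norm u * (opNorm M * e2norm v) :=
        mul_le_mul_of_nonneg_left (e2norm_mulVec_le M v) (e2norm_nonneg u)
    _ = _ := by ring

end OpNorm

section Entropy

theorem mul_log_sub_nonneg {a b : ℝ} (ha : 0 < a) (hb : 0 < b) :
    0 ≤ a * Real.log a - a * Real.log b - a + b := by
  have h := mul_le_mul_of_nonneg_left (Real.log_le_sub_one_of_pos (div_pos hb ha)) ha.le
  rw [Real.log_div hb.ne' ha.ne', mul_sub, mul_sub, mul_div_cancel₀ _ ha.ne'] at h
  linarith

theorem sq_posPart_div_left_le {a b : ℝ} (ha : 0 < a) (hb : 0 < b) :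
    max (a - b) 0 ^ 2 / a ≤ 2 * (a * Real.log a - a * Real.log b - a + b) := by
  rcases le_total a b with h | h
  · rw [max_eq_right (sub_nonpos.2 h)]
    simpa using mul_log_sub_nonneg ha hb
  · rw [max_eq_left (sub_nonneg.2 h)]
    set v := 1 - b / a with hv
    have hv0 : 0 ≤ v := by
      rw [hv, sub_nonneg, div_le_one ha]; exact h
    have hv1 : v < 1 := by
      have := div_pos hb ha
      linarith
    have hs := sum_le_hasSum (Finset.range 2) (fun i _ => by positivity)
      (Real.hasSum_pow_div_log_of_abs_lt_one (abs_lt.2 ⟨by linarith, hv1⟩))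
    have hlog : Real.log (1 - v) = Real.log b - Real.log a := by
      rw [hv, sub_sub_cancel, Real.log_div hb.ne' ha.ne']
    rw [hlog] at hs
    norm_num [Finset.sum_range_succ] at hs
    have hb' : b = a * (1 - v) := by
      rw [hv, sub_sub_cancel, mul_div_cancel₀ _ ha.ne']
    have e : (a - b) ^ 2 / a = a * v ^ 2 := by
      rw [div_eq_iff ha.ne', hb']; ring
    rw [e]
    have h2 := mul_le_mul_of_nonneg_left hs ha.le
    nlinarith

theorem sq_posPart_div_right_le {a b : ℝ} (ha : 0 < a) (hb : 0 < b) :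
    max (b - a) 0 ^ 2 / b ≤ 2 * (a * Real.log a - a * Real.log b - a + b) := by
  rcases le_total b a with h | h
  · rw [max_eq_right (sub_nonpos.2 h)]
    simpa using mul_log_sub_nonneg ha hb
  · rw [max_eq_left (sub_nonneg.2 h)]
    have h1 : Real.log (b / a) ≤ Real.sinh (Real.log (b / a)) :=
      Real.self_le_sinh_iff.2 (Real.log_nonneg ((one_le_div ha).2 h))
    rw [Real.sinh_log (div_pos hb ha), Real.log_div hb.ne' ha.ne', inv_div] at h1
    have h2 := mul_le_mul_of_nonneg_left h1 ha.le
    have e1 : a * ((b / a - a / b) / 2) = (b - a ^ 2 / b) / 2 := by field_simp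
    have e2 : (b - a) ^ 2 / b = b - 2 * a + a ^ 2 / b := by field_simp; ring
    rw [e1] at h2
    rw [e2]
    linarith

variable {Ω : Type*} [MeasurableSpace Ω] {P : Measure Ω} [IsProbabilityMeasure P]

theorem integral_le_two_mul_entropy_sub {c M : ℝ} (hc : 0 < c) {g h D : Ω → ℝ}
    (hg : Measurable g) (hh : Measurable h) (hgI : ∀ ω, g ω ∈ Set.Icc c M)
    (hhI : ∀ ω, h ω ∈ Set.Icc c M) (hint : ∫ ω, g ω ∂P = ∫ ω, h ω ∂P)
    (hlog : ∫ ω, Real.log (h ω) * g ω ∂P = ∫ ω, Real.log (h ω) * h ω ∂P)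
    (hD0 : ∀ ω, 0 ≤ D ω)
    (hD : ∀ ω, D ω ≤ 2 * (g ω * Real.log (g ω) - g ω * Real.log (h ω) - g ω + h ω)) :
    ∫ ω, D ω ∂P ≤
      2 * (∫ ω, g ω * Real.log (g ω) ∂P - ∫ ω, h ω * Real.log (h ω) ∂P) := by
  have hb : ∀ {k : Ω → ℝ}, (∀ ω, k ω ∈ Set.Icc c M) → ∀ ω, |k ω| ≤ M := fun hk ω => by
    rw [abs_of_pos (hc.trans_le (hk ω).1)]; exact (hk ω).2
  have hl : ∀ {k : Ω → ℝ}, (∀ ω, k ω ∈ Set.Icc c M) → ∀ ω,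
      |Real.log (k ω)| ≤ max |Real.log c| |Real.log M| := fun hk ω =>
    abs_le_max_abs_abs (Real.log_le_log hc (hk ω).1)
      (Real.log_le_log (hc.trans_le (hk ω).1) (hk ω).2)
  have hI : ∀ {k l : Ω → ℝ}, Measurable k → Measurable l → (∀ ω, k ω ∈ Set.Icc c M) →
      (∀ ω, l ω ∈ Set.Icc c M) → Integrable (fun ω => k ω * Real.log (l ω)) P :=
    fun hk hl' hkI hlI => integrable_of_measurable_of_abs_le (hk.mul hl'.log) fun ω => by
      rw [abs_mul]
      exact mul_le_mul (hb hkI ω) (hl hlI ω) (abs_nonneg _) ((abs_nonneg _).trans (hb hkI ω))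
  have hgi : Integrable g P := integrable_of_measurable_of_abs_le hg (hb hgI)
  have hhi : Integrable h P := integrable_of_measurable_of_abs_le hh (hb hhI)
  have h12 := (hI hg hg hgI hgI).sub (hI hg hh hgI hhI)
  have h123 := h12.sub hgi
  have h1234 := h123.add hhi
  calc ∫ ω, D ω ∂P
      ≤ ∫ ω, 2 * (g ω * Real.log (g ω) - g ω * Real.log (h ω) - g ω + h ω) ∂P :=
        integral_mono_of_nonneg (ae_of_all _ hD0) (h1234.const_mul 2) (ae_of_all _ hD)
    _ = _ := by
        rw [integral_const_mul, integral_add (f := fun ω => g ω * Real.log (g ω) -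
          g ω * Real.log (h ω) - g ω) h123 hhi, integral_sub (f := fun ω => g ω * Real.log (g ω) -
          g ω * Real.log (h ω)) h12 hgi, integral_sub (hI hg hg hgI hgI) (hI hg hh hgI hhI), hint]
        simp_rw [mul_comm (Real.log _)] at hlog
        rw [hlog]
        ring

end Entropy

/-- The filtration `{∅, Ω}, σ(x 0), σ(x 0, x 1), …`. -/
@[reducible] def shiftedPast {Ω S : Type*} [MeasurableSpace S] (x : ℕ → Ω → S) :
    ℕ → MeasurableSpace Ω
  | 0 => ⊥
  | k + 1 => pastFiltration x k

theorem shiftedPast_le_succ {Ω S : Type*} [MeasurableSpace S] (x : ℕ → Ω → S) (k : ℕ) :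
    shiftedPast x k ≤ shiftedPast x (k + 1) := by
  cases k with
  | zero => exact bot_le
  | succ k => exact pastFiltration_mono x (Nat.le_succ k)

theorem shiftedPast_le {Ω S : Type*} [m0 : MeasurableSpace Ω] [MeasurableSpace S]
    {x : ℕ → Ω → S} {n k : ℕ} (hx : ∀ i < n, Measurable (x i)) (hk : k ≤ n) :
    shiftedPast x k ≤ m0 := by
  cases k with
  | zero => exact bot_le
  | succ k => exact pastFiltration_le fun i hi => hx i (by omega)

section Chain

variable {Ω S : Type*} [MeasurableSpace Ω] [MeasurableSpace S] {P : Measure Ω}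
  [IsProbabilityMeasure P] {T : Kernel S S} [IsMarkovKernel T] {x : ℕ → Ω → S} {n : ℕ}

theorem IsMarkovChain.kernelIter_succ_comp_tiltedLaw (hx : IsMarkovChain P T x n) {t : ℕ}
    (ht : t + 1 < n) {w : Ω → ℝ} (hw : Measurable[pastFiltration x t] w) {M : ℝ}
    (hwM : ∀ ω, w ω ∈ Set.Icc 0 M) (i : ℕ) :
    kernelIter T (i + 1) ∘ₘ tiltedLaw P w (x t) = kernelIter T i ∘ₘ tiltedLaw P w (x (t + 1)) := by
  rw [← hx.comp_tiltedLaw ht hw hwM, Measure.comp_assoc, kernelIter_comp_self]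
  rfl

theorem IsMarkovChain.kernelIter_comp_map (hx : IsMarkovChain P T x n) :
    ∀ i t : ℕ, t + i < n → kernelIter T i ∘ₘ P.map (x t) = P.map (x (t + i)) := by
  intro i
  induction i with
  | zero => intro t _; simp [kernelIter]
  | succ i ih =>
    intro t ht
    rw [← tiltedLaw_one (P := P), hx.kernelIter_succ_comp_tiltedLaw (by omega) measurable_const
      (M := 1) (fun _ => ⟨zero_le_one, le_rfl⟩), tiltedLaw_one, ih (t + 1) (by omega)]
    congr 2
    omega

theorem IsMarkovChain.transportBound_tiltedLaw (hx : IsMarkovChain P T x n) {c M : ℝ}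
    (hc : 0 < c) {G : ℕ → Ω → ℝ} (hGm : ∀ k ≤ n, Measurable[shiftedPast x k] (G k))
    (hGI : ∀ k ≤ n, ∀ ω, G k ω ∈ Set.Icc c M) (hG0 : G 0 = fun _ => 1)
    (hGint : ∀ k ≤ n, ∫ ω, G k ω ∂P = 1) {j : ℕ} (hj : j < n) :
    TransportBound (P.map (x j)) (tiltedLaw P (G (j + 1)) (x j))
        (∑ k ∈ Finset.range (j + 1), depCoeff T k j *
          √(∫ ω, max (G (k + 1) ω - G k ω) 0 ^ 2 / G (k + 1) ω ∂P)) ∧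
      TransportBound (tiltedLaw P (G (j + 1)) (x j)) (P.map (x j))
        (∑ k ∈ Finset.range (j + 1), depCoeff T k j *
          √(∫ ω, max (G k ω - G (k + 1) ω) 0 ^ 2 / G k ω ∂P)) := by
  have hGm' : ∀ k ≤ n, Measurable (G k) := fun k hk =>
    (hGm k hk).mono (shiftedPast_le hx.1 hk) le_rfl
  have hfin : ∀ k ≤ n, ∀ X : Ω → S, IsFiniteMeasure (tiltedLaw P (G k) X) := fun k hk X =>
    isFiniteMeasure_tiltedLaw (hGm' k hk) (M := M) (fun ω => by
      rw [abs_of_pos (hc.trans_le (hGI k hk ω).1)]; exact (hGI k hk ω).2) X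
  set A : ℕ → ℝ := fun k => depCoeff T k j *
    √(∫ ω, max (G (k + 1) ω - G k ω) 0 ^ 2 / G (k + 1) ω ∂P) with hA
  set B : ℕ → ℝ := fun k => depCoeff T k j *
    √(∫ ω, max (G k ω - G (k + 1) ω) 0 ^ 2 / G k ω ∂P) with hB
  have hA0 : ∀ k, 0 ≤ A k := fun k => mul_nonneg (depCoeff_nonneg T k j) (Real.sqrt_nonneg _)
  have hB0 : ∀ k, 0 ≤ B k := fun k => mul_nonneg (depCoeff_nonneg T k j) (Real.sqrt_nonneg _)
  have step : ∀ i ≤ j,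
      TransportBound (kernelIter T (j - i) ∘ₘ tiltedLaw P (G i) (x i))
        (kernelIter T (j - i) ∘ₘ tiltedLaw P (G (i + 1)) (x i)) (A i) ∧
      TransportBound (kernelIter T (j - i) ∘ₘ tiltedLaw P (G (i + 1)) (x i))
        (kernelIter T (j - i) ∘ₘ tiltedLaw P (G i) (x i)) (B i) := by
    intro i hi
    have h1 : i ≤ n := by omega
    have h2 : i + 1 ≤ n := by omega
    have he : ∫ ω, G (i + 1) ω ∂P = ∫ ω, G i ω ∂P := by rw [hGint _ h1, hGint _ h2]
    exact ⟨transportBound_kernel_comp_tiltedLaw (hx.1 i (by omega)) _ (depCoeff_nonneg T i j)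
        (transportBound_kernelIter T hi) hc (hGm' _ h2) (hGm' _ h1) (hGI _ h2) (hGI _ h1) he,
      transportBound_kernel_comp_tiltedLaw (hx.1 i (by omega)) _ (depCoeff_nonneg T i j)
        (transportBound_kernelIter T hi) hc (hGm' _ h1) (hGm' _ h2) (hGI _ h1) (hGI _ h2) he.symm⟩
  have main : ∀ i ≤ j,
      TransportBound (P.map (x j)) (kernelIter T (j - i) ∘ₘ tiltedLaw P (G (i + 1)) (x i))
        (∑ k ∈ Finset.range (i + 1), A k) ∧
      TransportBound (kernelIter T (j - i) ∘ₘ tiltedLaw P (G (i + 1)) (x i)) (P.map (x j))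
        (∑ k ∈ Finset.range (i + 1), B k) := by
    intro i
    induction i with
    | zero =>
      intro h
      have h0 : kernelIter T (j - 0) ∘ₘ tiltedLaw P (G 0) (x 0) = P.map (x j) := by
        rw [hG0, tiltedLaw_one, hx.kernelIter_comp_map _ _ (by omega)]
        simp
      have := step 0 h
      rw [h0] at this
      simpa using this
    | succ i ih =>
      intro h
      have h1 : kernelIter T (j - i) ∘ₘ tiltedLaw P (G (i + 1)) (x i) =
          kernelIter T (j - (i + 1)) ∘ₘ tiltedLaw P (G (i + 1)) (x (i + 1)) := by
        have e : j - i = j - (i + 1) + 1 := by omega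
        rw [e, hx.kernelIter_succ_comp_tiltedLaw (by omega) (hGm (i + 1) (by omega)) (M := M)
          (fun ω => ⟨hc.le.trans (hGI _ (by omega) ω).1, (hGI _ (by omega) ω).2⟩)]
      have ih := ih (by omega)
      have hs := step (i + 1) h
      rw [h1] at ih
      have := hfin (i + 1) (by omega) (x (i + 1))
      have := hfin (i + 1 + 1) (by omega) (x (i + 1))
      refine ⟨?_, ?_⟩
      · rw [Finset.sum_range_succ]
        exact ih.1.trans (Finset.sum_nonneg fun k _ => hA0 k) (hA0 _) hs.1
      · rw [Finset.sum_range_succ, add_comm (∑ k ∈ Finset.range (i + 1), B k)]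
        exact hs.2.trans (hB0 _) (Finset.sum_nonneg fun k _ => hB0 k) ih.2
  have := main j le_rfl
  simpa [kernelIter] using this

theorem exists_shiftedPast_densities (hx : ∀ i < n, Measurable (x i)) {g : Ω → ℝ}
    (hg : Measurable g) {c M : ℝ} (hgI : ∀ ω, g ω ∈ Set.Icc c M) (hg1 : ∫ ω, g ω ∂P = 1) :
    ∃ G : ℕ → Ω → ℝ, G 0 = (fun _ => 1) ∧ ∀ k ≤ n, Measurable[shiftedPast x k] (G k) ∧
      (∀ ω, G k ω ∈ Set.Icc c M) ∧
      ∀ w : Ω → ℝ, Measurable[shiftedPast x k] w → ∀ B : ℝ, (∀ ω, |w ω| ≤ B) →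
        ∫ ω, w ω * g ω ∂P = ∫ ω, w ω * G k ω ∂P := by
  have h : ∀ k, ∃ G : Ω → ℝ, k ≤ n → Measurable[shiftedPast x k] G ∧
      (∀ ω, G ω ∈ Set.Icc c M) ∧
      ∀ w : Ω → ℝ, Measurable[shiftedPast x k] w → ∀ B : ℝ, (∀ ω, |w ω| ≤ B) →
        ∫ ω, w ω * g ω ∂P = ∫ ω, w ω * G ω ∂P := by
    intro k
    by_cases hk : k ≤ n
    · obtain ⟨G, hG⟩ := exists_bounded_condExp (shiftedPast_le hx hk) P hg hgI
      exact ⟨G, fun _ => hG⟩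
    · exact ⟨0, fun h => absurd h hk⟩
  choose G hG using h
  refine ⟨G, ?_, hG⟩
  obtain ⟨hm, -, hw⟩ := hG 0 (Nat.zero_le n)
  obtain ⟨a, ha⟩ := stronglyMeasurable_bot_iff.1 (Measurable.stronglyMeasurable hm)
  have := hw (fun _ => 1) measurable_const 1 (by simp)
  simp only [one_mul, hg1, ha, integral_const, probReal_univ, smul_eq_mul] at this
  rw [ha, ← this]

theorem IsMarkovChain.transport_inequality (hx : IsMarkovChain P T x n) {b : ℝ} {f : S → ℝ}
    (hf : Measurable f) (hfb : ∀ s, f s ∈ Set.Icc 0 b) {g : Ω → ℝ} (hg : Measurable g)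
    {c M : ℝ} (hc : 0 < c) (hgI : ∀ ω, g ω ∈ Set.Icc c M) (hg1 : ∫ ω, g ω ∂P = 1) :
    (∫ ω, g ω * ∑ j ∈ Finset.range n, f (x j ω) ∂P - ∫ ω, ∑ j ∈ Finset.range n, f (x j ω) ∂P ≤
      opNorm (depMatrix T n) * √(2 * ∫ ω, g ω * Real.log (g ω) ∂P) *
        √(b * ∫ ω, g ω * ∑ j ∈ Finset.range n, f (x j ω) ∂P)) ∧
    (∫ ω, ∑ j ∈ Finset.range n, f (x j ω) ∂P - ∫ ω, g ω * ∑ j ∈ Finset.range n, f (x j ω) ∂P ≤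
      opNorm (depMatrix T n) * √(2 * ∫ ω, g ω * Real.log (g ω) ∂P) *
        √(b * ∫ ω, ∑ j ∈ Finset.range n, f (x j ω) ∂P)) := by
  obtain ⟨G, hG0, hG⟩ := exists_shiftedPast_densities (P := P) (x := x) hx.1 hg hgI hg1
  have hGm' : ∀ k ≤ n, Measurable (G k) := fun k hk =>
    (hG k hk).1.mono (shiftedPast_le hx.1 hk) le_rfl
  have hpos : ∀ k ≤ n, ∀ ω, 0 < G k ω := fun k hk ω => hc.trans_le ((hG k hk).2.1 ω).1
  have hgpos : ∀ ω, 0 < g ω := fun ω => hc.trans_le (hgI ω).1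
  have hGint : ∀ k ≤ n, ∫ ω, G k ω ∂P = 1 := fun k hk => by
    have := (hG k hk).2.2 (fun _ => 1) measurable_const 1 (by simp)
    simpa [hg1] using this.symm
  have hlogm : ∀ k ≤ n, Measurable[shiftedPast x k] fun ω => Real.log (G k ω) := fun k hk =>
    Real.measurable_log.comp (hG k hk).1
  have hlogb : ∀ k ≤ n, ∀ ω, |Real.log (G k ω)| ≤ max |Real.log c| |Real.log M| := fun k hk ω =>
    abs_le_max_abs_abs (Real.log_le_log hc ((hG k hk).2.1 ω).1)
      (Real.log_le_log (hpos k hk ω) ((hG k hk).2.1 ω).2)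
  set E : ℕ → ℝ := fun k => ∫ ω, G k ω * Real.log (G k ω) ∂P with hE
  have hEn : E n ≤ ∫ ω, g ω * Real.log (g ω) ∂P := by
    have := integral_le_two_mul_entropy_sub (P := P) (D := fun _ => 0) hc hg (hGm' n le_rfl) hgI
      (hG n le_rfl).2.1 (by rw [hg1, hGint n le_rfl])
      ((hG n le_rfl).2.2 _ (hlogm n le_rfl) _ (hlogb n le_rfl)) (fun _ => le_rfl) fun ω =>
        mul_nonneg zero_le_two (mul_log_sub_nonneg (hgpos ω) (hpos n le_rfl ω))
    rw [integral_zero] at this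
    linarith
  have hE0 : E 0 = 0 := by simp [hE, hG0]
  have hstep : ∀ k < n, ∀ D : Ω → ℝ, (∀ ω, 0 ≤ D ω) →
      (∀ ω, D ω ≤ 2 * (G (k + 1) ω * Real.log (G (k + 1) ω) -
        G (k + 1) ω * Real.log (G k ω) - G (k + 1) ω + G k ω)) →
      ∫ ω, D ω ∂P ≤ 2 * (E (k + 1) - E k) := by
    intro k hk D hD0 hD
    have h1 : k ≤ n := hk.le
    have h2 : k + 1 ≤ n := hk
    refine integral_le_two_mul_entropy_sub hc (hGm' _ h2) (hGm' _ h1) (hG _ h2).2.1 (hG _ h1).2.1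
      (by rw [hGint _ h1, hGint _ h2]) ?_ hD0 hD
    rw [← (hG k h1).2.2 _ (hlogm k h1) _ (hlogb k h1),
      ← (hG (k + 1) h2).2.2 _ ((hlogm k h1).mono (shiftedPast_le_succ x k) le_rfl) _ (hlogb k h1)]
  have hent : ∀ D : ℕ → Ω → ℝ, (∀ k < n, ∀ ω, 0 ≤ D k ω) →
      (∀ k < n, ∀ ω, D k ω ≤ 2 * (G (k + 1) ω * Real.log (G (k + 1) ω) -
        G (k + 1) ω * Real.log (G k ω) - G (k + 1) ω + G k ω)) →
      e2norm (fun k : Fin n => √(∫ ω, D k ω ∂P)) ≤ √(2 * ∫ ω, g ω * Real.log (g ω) ∂P) := by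
    intro D hD0 hD
    refine Real.sqrt_le_sqrt ?_
    calc ∑ k : Fin n, √(∫ ω, D k ω ∂P) ^ 2 = ∑ k : Fin n, ∫ ω, D k ω ∂P :=
          Finset.sum_congr rfl fun k _ => Real.sq_sqrt (integral_nonneg (hD0 k k.2))
      _ = ∑ k ∈ Finset.range n, ∫ ω, D k ω ∂P :=
          Fin.sum_univ_eq_sum_range (fun k => ∫ ω, D k ω ∂P) n
      _ ≤ ∑ k ∈ Finset.range n, 2 * (E (k + 1) - E k) := Finset.sum_le_sum fun k hk =>
          hstep k (Finset.mem_range.1 hk) _ (hD0 k (Finset.mem_range.1 hk))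
            (hD k (Finset.mem_range.1 hk))
      _ = 2 * E n := by rw [← Finset.mul_sum, Finset.sum_range_sub, hE0, sub_zero]
      _ ≤ _ := by linarith
  have habs : ∀ s, |f s| ≤ b := fun s => by rw [abs_of_nonneg (hfb s).1]; exact (hfb s).2
  have hfi : ∀ j < n, Integrable (fun ω => f (x j ω)) P := fun j hj =>
    integrable_of_measurable_of_abs_le (hf.comp (hx.1 j hj)) fun ω => habs _
  have hgfi : ∀ j < n, Integrable (fun ω => g ω * f (x j ω)) P := fun j hj =>
    integrable_of_measurable_of_abs_le (hg.mul (hf.comp (hx.1 j hj))) (B := M * b) fun ω => by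
      rw [abs_mul, abs_of_pos (hgpos ω)]
      exact mul_le_mul (hgI ω).2 (habs _) (abs_nonneg _) ((hgpos ω).le.trans (hgI ω).2)
  have hsumP : ∫ ω, ∑ j ∈ Finset.range n, f (x j ω) ∂P =
      ∑ j : Fin n, ∫ ω, f (x j ω) ∂P := by
    rw [integral_finsetSum _ fun j hj => hfi j (Finset.mem_range.1 hj),
      Fin.sum_univ_eq_sum_range (fun j => ∫ ω, f (x j ω) ∂P) n]
  have hsumQ : ∫ ω, g ω * ∑ j ∈ Finset.range n, f (x j ω) ∂P =
      ∑ j : Fin n, ∫ ω, g ω * f (x j ω) ∂P := by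
    simp_rw [Finset.mul_sum]
    rw [integral_finsetSum _ fun j hj => hgfi j (Finset.mem_range.1 hj),
      Fin.sum_univ_eq_sum_range (fun j => ∫ ω, g ω * f (x j ω) ∂P) n]
  have hP : ∀ j < n, ∀ h : S → ℝ, Measurable h →
      ∫ s, h s ∂(P.map (x j)) = ∫ ω, h (x j ω) ∂P := fun j hj h hh =>
    integral_map (hx.1 j hj).aemeasurable hh.aestronglyMeasurable
  have hQ : ∀ j < n, ∀ h : S → ℝ, Measurable h → ∀ B : ℝ, (∀ s, |h s| ≤ B) →
      ∫ s, h s ∂(tiltedLaw P (G (j + 1)) (x j)) = ∫ ω, g ω * h (x j ω) ∂P := by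
    intro j hj h hh B hB
    rw [integral_tiltedLaw (hGm' _ hj) (fun ω => (hpos _ hj ω).le) (hx.1 j hj) hh]
    simp_rw [mul_comm _ (h _)]
    exact ((hG (j + 1) hj).2.2 _ (hh.comp (measurable_pastFiltration x le_rfl)) B
      fun ω => hB _).symm
  have hB2 : ∀ s, |f s ^ 2| ≤ b ^ 2 := fun s => by
    rw [abs_pow]; exact pow_le_pow_left₀ (abs_nonneg _) (habs s) 2
  have hsq : ∀ s, f s ^ 2 ≤ b * f s := fun s => by nlinarith [(hfb s).1, (hfb s).2]
  have hnormP : e2norm (fun j : Fin n => √(∫ ω, f (x j ω) ^ 2 ∂P)) ≤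
      √(b * ∫ ω, ∑ j ∈ Finset.range n, f (x j ω) ∂P) := by
    refine Real.sqrt_le_sqrt ?_
    rw [hsumP, Finset.mul_sum]
    refine Finset.sum_le_sum fun j _ => ?_
    rw [Real.sq_sqrt (integral_nonneg fun ω => sq_nonneg _), ← integral_const_mul]
    exact integral_mono_of_nonneg (ae_of_all _ fun ω => sq_nonneg _) ((hfi j j.2).const_mul b)
      (ae_of_all _ fun ω => hsq _)
  have hnormQ : e2norm (fun j : Fin n => √(∫ ω, g ω * f (x j ω) ^ 2 ∂P)) ≤
      √(b * ∫ ω, g ω * ∑ j ∈ Finset.range n, f (x j ω) ∂P) := by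
    refine Real.sqrt_le_sqrt ?_
    rw [hsumQ, Finset.mul_sum]
    refine Finset.sum_le_sum fun j _ => ?_
    have h0 : ∀ ω, 0 ≤ g ω * f (x j ω) ^ 2 := fun ω => mul_nonneg (hgpos ω).le (sq_nonneg _)
    rw [Real.sq_sqrt (integral_nonneg h0), ← integral_const_mul]
    refine integral_mono_of_nonneg (ae_of_all _ h0) ((hgfi j j.2).const_mul b)
      (ae_of_all _ fun ω => ?_)
    have := mul_le_mul_of_nonneg_left (hsq (x j ω)) (hgpos ω).le
    show g ω * f (x j ω) ^ 2 ≤ b * (g ω * f (x j ω))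
    linarith
  have hcoef : ∀ (a : ℕ → ℝ) (j : Fin n),
      ∑ k ∈ Finset.range ((j : ℕ) + 1), depCoeff T k j * a k =
        ∑ k : Fin n, depMatrix T n k j * a k := by
    intro a j
    simp_rw [depMatrix_apply]
    rw [Fin.sum_univ_eq_sum_range (fun k => depCoeff T k j * a k) n]
    refine Finset.sum_subset (Finset.range_mono j.2) fun k _ hk => ?_
    rw [depCoeff_eq_zero T (by simpa using hk), zero_mul]
  have htb := fun j : Fin n => hx.transportBound_tiltedLaw hc (fun k hk => (hG k hk).1)
    (fun k hk => (hG k hk).2.1) hG0 hGint j.2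
  have hop := opNorm_nonneg (depMatrix T n)
  constructor
  · calc _ = ∑ j : Fin n, (∫ ω, g ω * f (x j ω) ∂P - ∫ ω, f (x j ω) ∂P) := by
          rw [hsumP, hsumQ, Finset.sum_sub_distrib]
      _ ≤ ∑ j : Fin n, (∑ k : Fin n, depMatrix T n k j *
            √(∫ ω, max (G (k + 1) ω - G k ω) 0 ^ 2 / G (k + 1) ω ∂P)) *
              √(∫ ω, g ω * f (x j ω) ^ 2 ∂P) := by
          refine Finset.sum_le_sum fun j _ => ?_
          have h := (htb j).1 f hf (fun s => (hfb s).1) b fun s => (hfb s).2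
          rwa [hP j j.2 f hf, hQ j j.2 f hf b habs,
            hQ j j.2 (fun s => f s ^ 2) (hf.pow_const 2) _ hB2,
            hcoef (fun k => √(∫ ω, max (G (k + 1) ω - G k ω) 0 ^ 2 / G (k + 1) ω ∂P))] at h
      _ ≤ opNorm (depMatrix T n) * e2norm (fun k : Fin n =>
            √(∫ ω, max (G (k + 1) ω - G k ω) 0 ^ 2 / G (k + 1) ω ∂P)) *
              e2norm (fun j : Fin n => √(∫ ω, g ω * f (x j ω) ^ 2 ∂P)) :=
          sum_sum_mul_le_opNorm (depMatrix T n) (fun k : Fin n =>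
            √(∫ ω, max (G (k + 1) ω - G k ω) 0 ^ 2 / G (k + 1) ω ∂P)) _
      _ ≤ _ := by
          refine mul_le_mul (mul_le_mul_of_nonneg_left (hent (fun k ω =>
            max (G (k + 1) ω - G k ω) 0 ^ 2 / G (k + 1) ω) (fun k hk ω =>
              div_nonneg (sq_nonneg _) (hpos _ hk ω).le) fun k hk ω =>
                sq_posPart_div_left_le (hpos _ hk ω) (hpos _ hk.le ω)) hop) hnormQ
            (e2norm_nonneg _) (mul_nonneg hop (Real.sqrt_nonneg _))
  · calc _ = ∑ j : Fin n, (∫ ω, f (x j ω) ∂P - ∫ ω, g ω * f (x j ω) ∂P) := by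
          rw [hsumP, hsumQ, Finset.sum_sub_distrib]
      _ ≤ ∑ j : Fin n, (∑ k : Fin n, depMatrix T n k j *
            √(∫ ω, max (G k ω - G (k + 1) ω) 0 ^ 2 / G k ω ∂P)) *
              √(∫ ω, f (x j ω) ^ 2 ∂P) := by
          refine Finset.sum_le_sum fun j _ => ?_
          have h := (htb j).2 f hf (fun s => (hfb s).1) b fun s => (hfb s).2
          rwa [hP j j.2 f hf, hQ j j.2 f hf b habs,
            hP j j.2 (fun s => f s ^ 2) (hf.pow_const 2),
            hcoef (fun k => √(∫ ω, max (G k ω - G (k + 1) ω) 0 ^ 2 / G k ω ∂P))] at h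
      _ ≤ opNorm (depMatrix T n) * e2norm (fun k : Fin n =>
            √(∫ ω, max (G k ω - G (k + 1) ω) 0 ^ 2 / G k ω ∂P)) *
              e2norm (fun j : Fin n => √(∫ ω, f (x j ω) ^ 2 ∂P)) :=
          sum_sum_mul_le_opNorm (depMatrix T n) (fun k : Fin n =>
            √(∫ ω, max (G k ω - G (k + 1) ω) 0 ^ 2 / G k ω ∂P)) _
      _ ≤ _ := by
          refine mul_le_mul (mul_le_mul_of_nonneg_left (hent (fun k ω =>
            max (G k ω - G (k + 1) ω) 0 ^ 2 / G k ω) (fun k hk ω =>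
              div_nonneg (sq_nonneg _) (hpos _ hk.le ω).le) fun k hk ω =>
                sq_posPart_div_right_le (hpos _ hk ω) (hpos _ hk.le ω)) hop) hnormP
            (e2norm_nonneg _) (mul_nonneg hop (Real.sqrt_nonneg _))

end Chain

section Conditioning

variable {Ω S : Type*} [MeasurableSpace Ω] [MeasurableSpace S] {P : Measure Ω}
  [IsProbabilityMeasure P] {T : Kernel S S} {x : ℕ → Ω → S} {n : ℕ}

theorem mul_log_convexComb_one_le {δ u : ℝ} (hδ0 : 0 ≤ δ) (hδ1 : δ ≤ 1) (hu : 0 ≤ u) :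
    ((1 - δ) * u + δ) * Real.log ((1 - δ) * u + δ) ≤ (1 - δ) * (u * Real.log u) := by
  have h := Real.convexOn_mul_log.2 (Set.mem_Ici.2 hu) (Set.mem_Ici.2 zero_le_one)
    (sub_nonneg.2 hδ1) hδ0 (by ring)
  simpa using h

theorem IsMarkovChain.integrable_sum (hx : IsMarkovChain P T x n) {b : ℝ} {f : S → ℝ}
    (hf : Measurable f) (hfb : ∀ s, f s ∈ Set.Icc 0 b) :
    Integrable (fun ω => ∑ j ∈ Finset.range n, f (x j ω)) P :=
  integrable_finsetSum _ fun j hj =>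
    integrable_of_measurable_of_abs_le (hf.comp (hx.1 j (Finset.mem_range.1 hj))) (B := b)
      fun ω => by rw [abs_of_nonneg (hfb _).1]; exact (hfb _).2

variable [IsMarkovKernel T]

theorem IsMarkovChain.conditional_transport_inequality (hx : IsMarkovChain P T x n) {b : ℝ}
    {f : S → ℝ} (hf : Measurable f) (hfb : ∀ s, f s ∈ Set.Icc 0 b) {A : Set Ω}
    (hA : MeasurableSet A) (hp : 0 < P.real A) {m y : ℝ}
    (hm : m = ∫ ω, ∑ j ∈ Finset.range n, f (x j ω) ∂P)
    (hy : y = (P.real A)⁻¹ * ∫ ω in A, ∑ j ∈ Finset.range n, f (x j ω) ∂P) :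
    (y - m ≤ opNorm (depMatrix T n) * √(2 * -Real.log (P.real A)) * √(b * y)) ∧
    (m - y ≤ opNorm (depMatrix T n) * √(2 * -Real.log (P.real A)) * √(b * m)) := by
  set p := P.real A with hpdef
  set F : Ω → ℝ := fun ω => ∑ j ∈ Finset.range n, f (x j ω) with hF
  set u : Ω → ℝ := A.indicator fun _ => p⁻¹ with hu
  have hp1 : p ≤ 1 := measureReal_le_one
  have hlog : 0 ≤ -Real.log p := neg_nonneg.2 (Real.log_nonpos hp.le hp1)
  have hu0 : ∀ ω, 0 ≤ u ω := fun ω => Set.indicator_nonneg (fun _ _ => (inv_pos.2 hp).le) ω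
  have hu1 : ∀ ω, u ω ≤ p⁻¹ := fun ω =>
    Set.indicator_le_self' (fun _ _ => (inv_pos.2 hp).le) ω
  have hum : Measurable u := measurable_const.indicator hA
  have hui : Integrable u P := (integrable_const _).indicator hA
  have huint : ∫ ω, u ω ∂P = 1 := by
    rw [hu, integral_indicator_const _ hA, smul_eq_mul, ← hpdef, mul_inv_cancel₀ hp.ne']
  have hulog : (fun ω => u ω * Real.log (u ω)) = A.indicator fun _ => p⁻¹ * Real.log p⁻¹ := by
    ext ω
    by_cases h : ω ∈ A <;> simp [hu, h]
  have huloginteg : Integrable (fun ω => u ω * Real.log (u ω)) P := by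
    rw [hulog]; exact (integrable_const _).indicator hA
  have hulogint : ∫ ω, u ω * Real.log (u ω) ∂P = -Real.log p := by
    rw [hulog, integral_indicator_const _ hA, smul_eq_mul, ← hpdef,
      mul_inv_cancel_left₀ hp.ne', Real.log_inv]
  have hFi : Integrable F P := hx.integrable_sum hf hfb
  have huF : (fun ω => u ω * F ω) = A.indicator fun ω => p⁻¹ * F ω := by
    ext ω
    by_cases h : ω ∈ A <;> simp [hu, h]
  have huFi : Integrable (fun ω => u ω * F ω) P := by
    rw [huF]; exact (hFi.const_mul _).indicator hA
  have huFint : ∫ ω, u ω * F ω ∂P = y := by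
    rw [huF, integral_indicator hA, integral_const_mul, hy]
  have key : ∀ δ ∈ Set.Ioo (0 : ℝ) 1,
      ((1 - δ) * y + δ * m - m ≤
        opNorm (depMatrix T n) * √(2 * -Real.log p) * √(b * ((1 - δ) * y + δ * m))) ∧
      (m - ((1 - δ) * y + δ * m) ≤
        opNorm (depMatrix T n) * √(2 * -Real.log p) * √(b * m)) := by
    intro δ hδ
    have hδ' : 0 ≤ 1 - δ := by linarith [hδ.2]
    have hgI : ∀ ω, (1 - δ) * u ω + δ ∈ Set.Icc δ (p⁻¹ + δ) := fun ω =>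
      ⟨by nlinarith [hu0 ω], by nlinarith [hu0 ω, hu1 ω, hδ.1]⟩
    have hg1 : ∫ ω, ((1 - δ) * u ω + δ) ∂P = 1 := by
      rw [integral_add (hui.const_mul _) (integrable_const _), integral_const_mul, huint]
      simp
    have hgF : ∫ ω, ((1 - δ) * u ω + δ) * F ω ∂P = (1 - δ) * y + δ * m := by
      simp_rw [add_mul, mul_assoc]
      rw [integral_add (huFi.const_mul _) (hFi.const_mul _), integral_const_mul,
        integral_const_mul, huFint, hm]
    have hent : ∫ ω, ((1 - δ) * u ω + δ) * Real.log ((1 - δ) * u ω + δ) ∂P ≤ -Real.log p := by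
      have hgm : Measurable fun ω => (1 - δ) * u ω + δ := (hum.const_mul _).add_const _
      have hi : Integrable (fun ω => ((1 - δ) * u ω + δ) * Real.log ((1 - δ) * u ω + δ)) P :=
        integrable_of_measurable_of_abs_le (hgm.mul (Real.measurable_log.comp hgm))
          (B := (p⁻¹ + δ) * max |Real.log δ| |Real.log (p⁻¹ + δ)|) fun ω => by
          have hpos : 0 < (1 - δ) * u ω + δ := hδ.1.trans_le (hgI ω).1
          rw [abs_mul, abs_of_pos hpos]
          exact mul_le_mul (hgI ω).2 (abs_le_max_abs_abs (Real.log_le_log hδ.1 (hgI ω).1)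
            (Real.log_le_log hpos (hgI ω).2)) (abs_nonneg _) (hpos.le.trans (hgI ω).2)
      calc _ ≤ ∫ ω, (1 - δ) * (u ω * Real.log (u ω)) ∂P :=
            integral_mono hi (huloginteg.const_mul _) fun ω =>
              mul_log_convexComb_one_le hδ.1.le hδ.2.le (hu0 ω)
        _ = (1 - δ) * -Real.log p := by rw [integral_const_mul, hulogint]
        _ ≤ _ := by nlinarith [hδ.1]
    have h := hx.transport_inequality hf hfb ((hum.const_mul (1 - δ)).add_const δ) hδ.1 hgI hg1
    rw [hgF, ← hm] at h
    have hle := mul_le_mul_of_nonneg_left (Real.sqrt_le_sqrt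
      (mul_le_mul_of_nonneg_left hent zero_le_two)) (opNorm_nonneg (depMatrix T n))
    exact ⟨h.1.trans (mul_le_mul_of_nonneg_right hle (Real.sqrt_nonneg _)),
      h.2.trans (mul_le_mul_of_nonneg_right hle (Real.sqrt_nonneg _))⟩
  have hev : ∀ᶠ δ in nhdsWithin (0 : ℝ) (Set.Ioi 0), δ ∈ Set.Ioo (0 : ℝ) 1 :=
    Ioo_mem_nhdsGT zero_lt_one
  have hlim : ∀ h : ℝ → ℝ, Continuous h →
      Filter.Tendsto h (nhdsWithin 0 (Set.Ioi 0)) (nhds (h 0)) := fun h hh =>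
    hh.continuousWithinAt
  constructor
  · simpa using le_of_tendsto_of_tendsto
      (hlim (fun δ => (1 - δ) * y + δ * m - m) (by fun_prop))
      (hlim (fun δ => opNorm (depMatrix T n) * √(2 * -Real.log p) *
        √(b * ((1 - δ) * y + δ * m))) (by fun_prop)) (hev.mono fun δ hδ => (key δ hδ).1)
  · simpa using le_of_tendsto (hlim (fun δ => m - ((1 - δ) * y + δ * m)) (by fun_prop))
      (hev.mono fun δ hδ => (key δ hδ).2)

theorem sq_le_mul_of_sub_le_sqrt {a l b d w : ℝ} (hl : 0 ≤ l) (hbw : 0 ≤ b * w) (hd : 0 ≤ d)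
    (h : d ≤ a * √(2 * l) * √(b * w)) : d ^ 2 ≤ 2 * b * a ^ 2 * w * l := by
  calc d ^ 2 ≤ (a * √(2 * l) * √(b * w)) ^ 2 := pow_le_pow_left₀ hd h 2
    _ = 2 * b * a ^ 2 * w * l := by
      rw [mul_pow, mul_pow, Real.sq_sqrt (by positivity), Real.sq_sqrt hbw]
      ring

theorem sq_le_mul_add_of_sub_sq_le {k m t y : ℝ} (hk : 0 ≤ k) (hm : 0 ≤ m) (ht : 0 ≤ t)
    (hy : m + t ≤ y) (h : (y - m) ^ 2 ≤ k * y) : t ^ 2 ≤ k * (m + t) := by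
  rcases ht.eq_or_lt with rfl | ht
  · simpa using mul_nonneg hk hm
  · have hd : t ≤ y - m := by linarith
    have h1 : t ^ 2 * y ≤ (y - m) ^ 2 * (m + t) := by
      have h2 : t ^ 2 * m ≤ (y - m) ^ 2 * m :=
        mul_le_mul_of_nonneg_right (pow_le_pow_left₀ ht.le hd 2) hm
      have h3 : t * (y - m) * t ≤ t * (y - m) * (y - m) :=
        mul_le_mul_of_nonneg_left hd (mul_nonneg ht.le (ht.le.trans hd))
      nlinarith
    have h4 := mul_le_mul_of_nonneg_right h (add_nonneg hm ht.le)
    exact le_of_mul_le_mul_right (a := y) (by linarith) (by linarith)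

theorem measure_le_exp_of_le_mul_neg_log {A : Set Ω} {a d : ℝ} (hd : 0 ≤ d)
    (h : 0 < P.real A → a ≤ -Real.log (P.real A) * d) :
    P A ≤ ENNReal.ofReal (Real.exp (-a / d)) := by
  rw [← ofReal_measureReal]
  refine ENNReal.ofReal_le_ofReal ?_
  rcases measureReal_nonneg.eq_or_lt with hp | hp
  · rw [← hp]; exact (Real.exp_pos _).le
  · have hlog : 0 ≤ -Real.log (P.real A) :=
      neg_nonneg.2 (Real.log_nonpos hp.le measureReal_le_one)
    rw [← Real.log_le_iff_le_exp hp, neg_div]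
    linarith [div_le_of_le_mul₀ hd hlog (h hp)]

end Conditioning

/-- Samson-type Bernstein inequality for time-homogeneous Markov chains: for
`z = (1/n) ∑ᵢ f(xᵢ)` with `f` taking values in `[0, b]`, both tails of `z - E[z]` obey
an exponential bound governed by `‖Γₙ‖²`. -/
theorem samson_bernstein_markov
    {Ω S : Type*} [MeasurableSpace Ω] [MeasurableSpace S]
    (P : Measure Ω) [IsProbabilityMeasure P]
    (T : ProbabilityTheory.Kernel S S) [IsMarkovKernel T]
    (n : ℕ) (hn : 0 < n)
    (x : ℕ → Ω → S) (hchain : IsMarkovChain P T x n)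
    (b : ℝ) (f : S → ℝ) (hf : Measurable f) (hfb : ∀ s, f s ∈ Set.Icc 0 b)
    (z : Ω → ℝ) (hz : z = fun ω => (1 / (n : ℝ)) * ∑ i ∈ Finset.range n, f (x i ω))
    (ε : ℝ) (hε : 0 ≤ ε) :
    P {ω | z ω - ∫ ω', z ω' ∂P ≥ ε} ≤
      ENNReal.ofReal (Real.exp (-(ε ^ 2 * n) /
        (2 * b * opNorm (depMatrix T n) ^ 2 * ((∫ ω', z ω' ∂P) + ε)))) ∧
    P {ω | (∫ ω', z ω' ∂P) - z ω ≥ ε} ≤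
      ENNReal.ofReal (Real.exp (-(ε ^ 2 * n) /
        (2 * b * opNorm (depMatrix T n) ^ 2 * (∫ ω', z ω' ∂P)))) := by
  have hn' : (0 : ℝ) < n := Nat.cast_pos.2 hn
  set F : Ω → ℝ := fun ω => ∑ j ∈ Finset.range n, f (x j ω) with hF
  have hFm : Measurable F := Finset.measurable_sum _ fun j hj =>
    hf.comp (hchain.1 j (Finset.mem_range.1 hj))
  have hFz : ∀ ω, F ω = n * z ω := fun ω => by
    rw [hz, ← mul_assoc, mul_one_div_cancel hn'.ne', one_mul]
  have hF0 : ∀ ω, 0 ≤ F ω := fun ω => Finset.sum_nonneg fun j _ => (hfb _).1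
  have hFi : Integrable F P := hchain.integrable_sum hf hfb
  have hzm : Measurable z := by rw [hz]; exact hFm.const_mul _
  set e := ∫ ω, z ω ∂P with he
  have hFe : ∫ ω, F ω ∂P = n * e := by
    rw [he, ← integral_const_mul]; exact integral_congr_ae (ae_of_all _ hFz)
  have he0 : 0 ≤ e := by
    have : 0 ≤ n * e := hFe ▸ integral_nonneg hF0
    exact nonneg_of_mul_nonneg_right this hn'
  have hb : 0 ≤ b := by
    obtain ⟨ω⟩ : Nonempty Ω := P.nonempty_of_neZero
    exact (hfb (x 0 ω)).1.trans (hfb (x 0 ω)).2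
  set a := opNorm (depMatrix T n) with ha
  have hlog : ∀ A : Set Ω, 0 < P.real A → 0 ≤ -Real.log (P.real A) := fun A hp =>
    neg_nonneg.2 (Real.log_nonpos hp.le measureReal_le_one)
  have hcond : ∀ A : Set Ω, MeasurableSet A → 0 < P.real A → ∃ y : ℝ, 0 ≤ y ∧
      (∀ r, (∀ ω ∈ A, r ≤ F ω) → r ≤ y) ∧ (∀ r, (∀ ω ∈ A, F ω ≤ r) → y ≤ r) ∧
      (y - n * e ≤ a * √(2 * -Real.log (P.real A)) * √(b * y)) ∧
      (n * e - y ≤ a * √(2 * -Real.log (P.real A)) * √(b * (n * e))) := by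
    intro A hA hp
    have hconst : ∀ r : ℝ, ∫ _ in A, r ∂P = P.real A * r := fun r => by
      rw [setIntegral_const, smul_eq_mul]
    refine ⟨(P.real A)⁻¹ * ∫ ω in A, F ω ∂P, ?_, ?_, ?_,
      hchain.conditional_transport_inequality hf hfb hA hp hFe.symm rfl⟩
    · exact mul_nonneg (inv_nonneg.2 hp.le) (integral_nonneg hF0)
    · intro r hr
      rw [le_inv_mul_iff₀ hp, ← hconst]
      exact setIntegral_mono_on (integrable_const _).integrableOn hFi.integrableOn hA hr
    · intro r hr
      rw [inv_mul_le_iff₀ hp, ← hconst]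
      exact setIntegral_mono_on hFi.integrableOn (integrable_const _).integrableOn hA hr
  constructor
  · refine measure_le_exp_of_le_mul_neg_log (by positivity) fun hp => ?_
    have hl := hlog _ hp
    obtain ⟨y, hy0, hy, -, h, -⟩ := hcond _
      (measurableSet_le measurable_const (hzm.sub_const e)) hp
    have hy : n * e + n * ε ≤ y := hy _ fun ω hω => by
      have hω : ε ≤ z ω - e := hω
      rw [hFz]; nlinarith
    have ht : 0 ≤ n * ε := by positivity
    have h := sq_le_mul_of_sub_le_sqrt hl (mul_nonneg hb hy0) (by linarith) h
    have h := sq_le_mul_add_of_sub_sq_le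
      (k := 2 * b * a ^ 2 * -Real.log (P.real {ω | z ω - e ≥ ε}))
      (by positivity) (by positivity) ht hy (by linarith)
    exact le_of_mul_le_mul_left (a := (n : ℝ)) (by linarith) hn'
  · refine measure_le_exp_of_le_mul_neg_log (by positivity) fun hp => ?_
    have hl := hlog _ hp
    obtain ⟨y, -, -, hy, -, h⟩ := hcond _
      (measurableSet_le measurable_const (hzm.const_sub e)) hp
    have hy : y ≤ n * e - n * ε := hy _ fun ω hω => by
      have hω : ε ≤ e - z ω := hω
      rw [hFz]; nlinarith
    have ht : 0 ≤ n * ε := by positivity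
    have h := sq_le_mul_of_sub_le_sqrt hl (by positivity) ht (le_trans (by linarith) h)
    exact le_of_mul_le_mul_left (a := (n : ℝ)) (by linarith) hn'

end
end

section
/- Let x₁,…,xₙ be a time-homogeneous Markov chain on X ⊆ ℝ^D with stationary distribution ρ, uniformly quickly forgetting its past, with concentration constants c₁ > 0, c₂ ≥ 1 (depending only on the kernel), let Φ ∈ ℝ^{D×d} be fixed and m_max = max_{z∈X}‖zᵀΦ‖, and let ‖f‖ₙ² = (1/n)·Σ_{t=1}^n f(x_t)² denote the empirical L² norm on the sample. Then for any 0 < ε ≤ 1 and 0 < ξ < 1, with probability at least 1 − ξ, simultaneously for all v ∈ ℝ^d: ‖(xᵀΦ)v‖_ρ ≤ ‖(xᵀΦ)v‖ₙ + m_max·‖v‖·(2ε + ((c₁/n)·log(c₂·(3/ε)^d/ξ))^{1/4}). -/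
open MeasureTheory ProbabilityTheory Matrix

noncomputable section

/-- ρ-weighted L² norm of a real-valued function. -/
def l2ρ {α : Type*} [MeasurableSpace α] (ρ : Measure α) (f : α → ℝ) : ℝ :=
  Real.sqrt (∫ a, f a ^ 2 ∂ρ)

lemma card_le_of_separated_of_norm_le_one {E : Type*} [NormedAddCommGroup E] [NormedSpace ℝ E]
    [FiniteDimensional ℝ E] {ε : ℝ} (hε0 : 0 < ε) (hε1 : ε ≤ 1) (s : Finset E)
    (hs : ∀ c ∈ s, ‖c‖ ≤ 1) (h : ∀ c ∈ s, ∀ d ∈ s, c ≠ d → ε ≤ ‖c - d‖) :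
    (s.card : ℝ) ≤ (3 / ε) ^ Module.finrank ℝ E := by
  borelize E
  let μ : Measure E := Measure.addHaar
  have hδ : 0 < ε / 2 := by positivity
  have hdisj : Set.Pairwise (s : Set E)
      (Function.onFun Disjoint fun c => Metric.ball (c : E) (ε / 2)) := by
    rintro c hc d hd hcd
    apply Metric.ball_disjoint_ball
    rw [dist_eq_norm]
    linarith [h c hc d hd hcd]
  have hsub : ⋃ c ∈ s, Metric.ball (c : E) (ε / 2) ⊆ Metric.ball (0 : E) (3 / 2) := by
    refine Set.iUnion₂_subset fun x hx => Metric.ball_subset_ball' ?_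
    rw [dist_zero_right]
    linarith [hs x hx]
  have hvol : (s.card : ENNReal) * ENNReal.ofReal ((ε / 2) ^ Module.finrank ℝ E) *
      μ (Metric.ball 0 1) ≤
      ENNReal.ofReal ((3 / 2) ^ Module.finrank ℝ E) * μ (Metric.ball 0 1) :=
    calc
      _ = μ (⋃ c ∈ s, Metric.ball (c : E) (ε / 2)) := by
        rw [measure_biUnion_finset hdisj fun c _ => measurableSet_ball]
        simp only [μ.addHaar_ball_of_pos _ hδ, Finset.sum_const, nsmul_eq_mul, mul_assoc]
      _ ≤ μ (Metric.ball (0 : E) (3 / 2)) := measure_mono hsub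
      _ = _ := μ.addHaar_ball_of_pos _ (by norm_num)
  have hle := (ENNReal.mul_le_mul_iff_left (Metric.measure_ball_pos _ _ zero_lt_one).ne'
    measure_ball_lt_top.ne).1 hvol
  have hreal : (s.card : ℝ) * (ε / 2) ^ Module.finrank ℝ E ≤ (3 / 2) ^ Module.finrank ℝ E := by
    have := ENNReal.toReal_le_of_le_ofReal (by positivity) hle
    rwa [ENNReal.toReal_mul, ENNReal.toReal_natCast, ENNReal.toReal_ofReal (by positivity)] at this
  calc (s.card : ℝ) ≤ (3 / 2) ^ Module.finrank ℝ E / (ε / 2) ^ Module.finrank ℝ E :=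
        (le_div_iff₀ (by positivity)).2 hreal
    _ = _ := by rw [← div_pow]; congr 1; field_simp

lemma exists_finset_net_sphere {E : Type*} [NormedAddCommGroup E] [NormedSpace ℝ E]
    [FiniteDimensional ℝ E] {ε : ℝ} (hε0 : 0 < ε) (hε1 : ε ≤ 1) :
    ∃ s : Finset E, (∀ c ∈ s, ‖c‖ = 1) ∧ (∀ u : E, ‖u‖ = 1 → ∃ c ∈ s, ‖u - c‖ < ε) ∧
      (s.card : ℝ) ≤ (3 / ε) ^ Module.finrank ℝ E := by
  classical
  set S : Set ℕ := {k | ∃ s : Finset E, s.card = k ∧ (∀ c ∈ s, ‖c‖ = 1) ∧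
    ∀ c ∈ s, ∀ d ∈ s, c ≠ d → ε ≤ ‖c - d‖}
  have hbdd : BddAbove S := by
    refine ⟨⌊(3 / ε) ^ Module.finrank ℝ E⌋₊, ?_⟩
    rintro _ ⟨s, rfl, h1, h2⟩
    exact Nat.le_floor (card_le_of_separated_of_norm_le_one hε0 hε1 s (fun c hc => (h1 c hc).le) h2)
  obtain ⟨s, hcard, h1, h2⟩ : sSup S ∈ S := Nat.sSup_mem ⟨0, ∅, by simp⟩ hbdd
  refine ⟨s, h1, fun u hu => ?_,
    card_le_of_separated_of_norm_le_one hε0 hε1 s (fun c hc => (h1 c hc).le) h2⟩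
  by_contra! hfar
  have hus : u ∉ s := fun hus => by
    have := hfar u hus
    simp only [sub_self, norm_zero] at this
    linarith
  have hmem : s.card + 1 ∈ S := by
    refine ⟨insert u s, Finset.card_insert_of_notMem hus, ?_, ?_⟩
    · simpa [hu] using h1
    · intro c hc d hd hcd
      rcases Finset.mem_insert.1 hc with rfl | hcs <;>
        rcases Finset.mem_insert.1 hd with rfl | hds
      · exact absurd rfl hcd
      · exact hfar d hds
      · rw [norm_sub_rev]; exact hfar c hcs
      · exact h2 c hcs d hds hcd
  have := le_csSup hbdd hmem
  omega

lemma sqrt_add_le_sqrt_add_sqrt {a b : ℝ} (ha : 0 ≤ a) (hb : 0 ≤ b) :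
    Real.sqrt (a + b) ≤ Real.sqrt a + Real.sqrt b := by
  refine Real.sqrt_le_left (by positivity) |>.2 ?_
  nlinarith [Real.sq_sqrt ha, Real.sq_sqrt hb, Real.sqrt_nonneg a, Real.sqrt_nonneg b,
    mul_nonneg (Real.sqrt_nonneg a) (Real.sqrt_nonneg b)]

lemma e2norm_eq_norm {m : Type*} [Fintype m] (v : m → ℝ) : e2norm v = ‖WithLp.toLp 2 v‖ := by
  simp [e2norm, EuclideanSpace.norm_eq]

lemma e2norm_nonneg_s12 {m : Type*} [Fintype m] (v : m → ℝ) : 0 ≤ e2norm v := Real.sqrt_nonneg _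

lemma e2norm_smul_s12 {m : Type*} [Fintype m] (r : ℝ) (v : m → ℝ) :
    e2norm (r • v) = |r| * e2norm v := by
  simp only [e2norm_eq_norm, WithLp.toLp_smul, norm_smul, Real.norm_eq_abs]

lemma abs_dotProduct_le_e2norm_mul {m : Type*} [Fintype m] (u v : m → ℝ) :
    |u ⬝ᵥ v| ≤ e2norm u * e2norm v := by
  rw [e2norm, e2norm, ← Real.sqrt_mul (Finset.sum_nonneg fun i _ => sq_nonneg _)]
  exact Real.abs_le_sqrt (Finset.sum_mul_sq_le_sq_mul_sq _ _ _)

lemma e2norm_vecMul_le {m k : Type*} [Fintype m] [Fintype k] (z : m → ℝ) (Φ : Matrix m k ℝ) :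
    e2norm (Matrix.vecMul z Φ) ≤ e2norm z * Real.sqrt (∑ j, ∑ i, Φ i j ^ 2) := by
  rw [e2norm, e2norm, ← Real.sqrt_mul (Finset.sum_nonneg fun i _ => sq_nonneg _), Finset.mul_sum]
  exact Real.sqrt_le_sqrt (Finset.sum_le_sum fun j _ => Finset.sum_mul_sq_le_sq_mul_sq _ _ _)

lemma l2ρ_eq_toReal_eLpNorm {α : Type*} [MeasurableSpace α] {μ : Measure α} {f : α → ℝ}
    (hf : MemLp f 2 μ) : l2ρ μ f = (eLpNorm f 2 μ).toReal := by
  rw [hf.eLpNorm_eq_integral_rpow_norm (by simp) (by simp), ENNReal.toReal_ofReal (by positivity),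
    l2ρ, Real.sqrt_eq_rpow]
  simp

lemma l2ρ_smul {α : Type*} [MeasurableSpace α] (μ : Measure α) (r : ℝ) (f : α → ℝ) :
    l2ρ μ (fun a => r * f a) = |r| * l2ρ μ f := by
  simp only [l2ρ, mul_pow]
  rw [integral_const_mul, Real.sqrt_mul (sq_nonneg r), Real.sqrt_sq_eq_abs]

lemma l2ρ_le_add_of_ae_abs_sub_le {α : Type*} [MeasurableSpace α] {μ : Measure α}
    [IsProbabilityMeasure μ] {f g : α → ℝ} (hf : MemLp f 2 μ) (hg : MemLp g 2 μ) {C : ℝ}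
    (hC : 0 ≤ C) (h : ∀ᵐ a ∂μ, |f a - g a| ≤ C) : l2ρ μ f ≤ l2ρ μ g + C := by
  rw [l2ρ_eq_toReal_eLpNorm hf, l2ρ_eq_toReal_eLpNorm hg]
  have hfg : eLpNorm (f - g) 2 μ ≤ ENNReal.ofReal C := by
    simpa using eLpNorm_le_of_ae_bound (p := 2) (f := f - g) h
  have hle : eLpNorm f 2 μ ≤ eLpNorm g 2 μ + ENNReal.ofReal C := by
    calc eLpNorm f 2 μ = eLpNorm (g + (f - g)) 2 μ := by rw [add_sub_cancel]
      _ ≤ eLpNorm g 2 μ + eLpNorm (f - g) 2 μ :=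
        eLpNorm_add_le hg.1 (hf.1.sub hg.1) (by norm_num)
      _ ≤ _ := by gcongr
  calc (eLpNorm f 2 μ).toReal ≤ (eLpNorm g 2 μ + ENNReal.ofReal C).toReal :=
        ENNReal.toReal_mono (ENNReal.add_ne_top.2 ⟨hg.2.ne, ENNReal.ofReal_ne_top⟩) hle
    _ = _ := by rw [ENNReal.toReal_add hg.2.ne ENNReal.ofReal_ne_top, ENNReal.toReal_ofReal hC]

/-- The empirical measure of the points `y 0, …, y (n - 1)`. -/
def empiricalMeasure {α : Type*} [MeasurableSpace α] (n : ℕ) (y : ℕ → α) : Measure α :=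
  (n : ENNReal)⁻¹ • ∑ t ∈ Finset.range n, Measure.dirac (y t)

lemma isProbabilityMeasure_empiricalMeasure {α : Type*} [MeasurableSpace α] {n : ℕ} (hn : 0 < n)
    (y : ℕ → α) : IsProbabilityMeasure (empiricalMeasure n y) := by
  constructor
  simp only [empiricalMeasure, Measure.smul_apply, Measure.finsetSum_apply, measure_univ,
    Finset.sum_const, Finset.card_range, smul_eq_mul, nsmul_eq_mul, mul_one]
  exact ENNReal.inv_mul_cancel (by exact_mod_cast hn.ne') (by simp)

lemma l2ρ_empiricalMeasure {α : Type*} [MeasurableSpace α] (n : ℕ) (y : ℕ → α) {f : α → ℝ}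
    (hf : Measurable f) :
    l2ρ (empiricalMeasure n y) f =
      Real.sqrt ((1 / (n : ℝ)) * ∑ t ∈ Finset.range n, f (y t) ^ 2) := by
  have hm : StronglyMeasurable fun a => f a ^ 2 := (hf.pow_const 2).stronglyMeasurable
  rw [l2ρ, empiricalMeasure, integral_smul_measure, integral_finsetSum_measure]
  · simp [integral_dirac' _ _ hm]
  · intro t _
    exact (integrable_dirac' hm (by simp))

lemma ae_empiricalMeasure {α : Type*} [MeasurableSpace α] (n : ℕ) (y : ℕ → α) {p : α → Prop}
    (hp : MeasurableSet {a | p a}) (h : ∀ t < n, p (y t)) : ∀ᵐ a ∂(empiricalMeasure n y), p a := by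
  refine Measure.ae_smul_measure ?_ _
  rw [ae_iff, Measure.finsetSum_apply]
  refine Finset.sum_eq_zero fun t ht => ?_
  rw [← ae_iff, ae_dirac_iff hp]
  exact h t (Finset.mem_range.1 ht)

/-- A bound between the `L²` norms under two measures on a net of the unit sphere extends to all
vectors. -/
lemma l2ρ_le_of_net {D d : ℕ} {μ ν : Measure (Fin D → ℝ)} [IsProbabilityMeasure μ]
    [IsProbabilityMeasure ν] {Φ : Matrix (Fin D) (Fin d) ℝ} {M : ℝ} (hM : 0 ≤ M)
    (hμ : ∀ᵐ z ∂μ, e2norm (Matrix.vecMul z Φ) ≤ M) (hν : ∀ᵐ z ∂ν, e2norm (Matrix.vecMul z Φ) ≤ M)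
    {ε δ : ℝ} (hε : 0 ≤ ε) (s : Finset (EuclideanSpace ℝ (Fin d)))
    (hnet : ∀ u : EuclideanSpace ℝ (Fin d), ‖u‖ = 1 → ∃ c ∈ s, ‖u - c‖ < ε)
    (hs : ∀ c ∈ s, l2ρ μ (fun z => Matrix.vecMul z Φ ⬝ᵥ c.ofLp) ≤
      l2ρ ν (fun z => Matrix.vecMul z Φ ⬝ᵥ c.ofLp) + δ) (v : Fin d → ℝ) :
    l2ρ μ (fun z => Matrix.vecMul z Φ ⬝ᵥ v) ≤
      l2ρ ν (fun z => Matrix.vecMul z Φ ⬝ᵥ v) + e2norm v * (2 * (M * ε) + δ) := by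
  have hcont (w : Fin d → ℝ) : Continuous fun z => Matrix.vecMul z Φ ⬝ᵥ w := by
    unfold Matrix.vecMul dotProduct; fun_prop
  have hbound {κ : Measure (Fin D → ℝ)} (hκ : ∀ᵐ z ∂κ, e2norm (Matrix.vecMul z Φ) ≤ M)
      (w : Fin d → ℝ) : ∀ᵐ z ∂κ, |Matrix.vecMul z Φ ⬝ᵥ w| ≤ M * e2norm w := by
    filter_upwards [hκ] with z hz
    exact (abs_dotProduct_le_e2norm_mul _ _).trans
      (mul_le_mul_of_nonneg_right hz (e2norm_nonneg_s12 w))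
  have hmem {κ : Measure (Fin D → ℝ)} [IsProbabilityMeasure κ]
      (hκ : ∀ᵐ z ∂κ, e2norm (Matrix.vecMul z Φ) ≤ M) (w : Fin d → ℝ) :
      MemLp (fun z => Matrix.vecMul z Φ ⬝ᵥ w) 2 κ :=
    MemLp.of_bound (hcont w).aestronglyMeasurable _ (hbound hκ w)
  have hclose {κ : Measure (Fin D → ℝ)} [IsProbabilityMeasure κ]
      (hκ : ∀ᵐ z ∂κ, e2norm (Matrix.vecMul z Φ) ≤ M) (w w' : Fin d → ℝ)
      (hw : e2norm (w - w') ≤ ε) :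
      l2ρ κ (fun z => Matrix.vecMul z Φ ⬝ᵥ w) ≤
        l2ρ κ (fun z => Matrix.vecMul z Φ ⬝ᵥ w') + M * ε := by
    refine l2ρ_le_add_of_ae_abs_sub_le (hmem hκ w) (hmem hκ w') (by positivity) ?_
    filter_upwards [hbound hκ (w - w')] with z hz
    rw [← dotProduct_sub]
    exact hz.trans (mul_le_mul_of_nonneg_left hw hM)
  have hunit (u : Fin d → ℝ) (hu : e2norm u = 1) :
      l2ρ μ (fun z => Matrix.vecMul z Φ ⬝ᵥ u) ≤
        l2ρ ν (fun z => Matrix.vecMul z Φ ⬝ᵥ u) + (2 * (M * ε) + δ) := by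
    obtain ⟨c, hc, hcu⟩ := hnet (WithLp.toLp 2 u) (by rw [← e2norm_eq_norm, hu])
    have h1 := hclose hμ u c.ofLp (by rw [e2norm_eq_norm, WithLp.toLp_sub]; exact hcu.le)
    have h2 := hclose hν c.ofLp u (by
      rw [e2norm_eq_norm, WithLp.toLp_sub, norm_sub_rev]; exact hcu.le)
    linarith [hs c hc]
  rcases (e2norm_nonneg_s12 v).eq_or_lt with hv | hv
  · have hv0 : v = 0 := by
      rw [e2norm_eq_norm, eq_comm, norm_eq_zero] at hv
      simpa using hv
    simp [hv0, l2ρ, e2norm]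
  · have hu : e2norm ((e2norm v)⁻¹ • v) = 1 := by
      rw [e2norm_smul_s12, abs_of_pos (inv_pos.2 hv), inv_mul_cancel₀ hv.ne']
    have hscale (κ : Measure (Fin D → ℝ)) : l2ρ κ (fun z => Matrix.vecMul z Φ ⬝ᵥ v) =
        e2norm v * l2ρ κ (fun z => Matrix.vecMul z Φ ⬝ᵥ ((e2norm v)⁻¹ • v)) := by
      simp only [dotProduct_smul, smul_eq_mul, l2ρ_smul]
      rw [abs_of_pos (inv_pos.2 hv), mul_inv_cancel_left₀ hv.ne']
    rw [hscale μ, hscale ν, ← mul_add]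
    exact mul_le_mul_of_nonneg_left (hunit _ hu) hv.le

/-- Uniform (over the compressed linear class) relation between the ρ-weighted and the
empirical L² norms for a mixing Markov sample: with probability at least `1 - ξ`,
simultaneously for all `v ∈ ℝᵈ`,
`‖(xᵀΦ)v‖_ρ ≤ ‖(xᵀΦ)v‖ₙ + m_max ‖v‖ (2ε + ((c₁/n) log(c₂(3/ε)^d/ξ))^{1/4})`. -/
theorem uniform_population_vs_empirical_norm
    {Ω : Type*} [MeasurableSpace Ω] (P : Measure Ω) [IsProbabilityMeasure P]
    (D d n : ℕ) (hn : 0 < n)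
    (Xset : Set (Fin D → ℝ)) (hXnorm : ∀ z ∈ Xset, e2norm z ≤ 1)
    (x : ℕ → Ω → (Fin D → ℝ)) (hxmeas : ∀ t, t < n → Measurable (x t))
    (hxX : ∀ t, t < n → ∀ ω, x t ω ∈ Xset)
    (ρ : Measure (Fin D → ℝ)) [IsProbabilityMeasure ρ] (hρ : ∀ᵐ z ∂ρ, z ∈ Xset)
    (hstat : ∀ t, t < n → Measure.map (x t) P = ρ)
    -- the concentration constants `c₁ > 0`, `c₂ ≥ 1` of the uniformly quickly mixing
    -- chain (depending only on the transition kernel):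
    (c₁ c₂ : ℝ) (hc₁ : 0 < c₁) (hc₂ : 1 ≤ c₂)
    (hConc : ∀ (b : ℝ) (f : (Fin D → ℝ) → ℝ), Measurable f → (∀ s, f s ∈ Set.Icc 0 b) →
      ∀ (ξ : ℝ), 0 < ξ → ξ < 1 →
        1 - ENNReal.ofReal ξ ≤
          P {ω | |(∫ ω', (1 / (n : ℝ)) * ∑ t ∈ Finset.range n, f (x t ω') ∂P) -
                  (1 / (n : ℝ)) * ∑ t ∈ Finset.range n, f (x t ω)| ≤
                b * Real.sqrt (c₁ / n * Real.log (c₂ / ξ))})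
    (Φ : Matrix (Fin D) (Fin d) ℝ)
    (mmax : ℝ) (hmmax : mmax = sSup {r | ∃ z ∈ Xset, r = e2norm (Matrix.vecMul z Φ)})
    (ε : ℝ) (hε0 : 0 < ε) (hε1 : ε ≤ 1)
    (ξ : ℝ) (hξ0 : 0 < ξ) (hξ1 : ξ < 1) :
    1 - ENNReal.ofReal ξ ≤
      P {ω | ∀ v : Fin d → ℝ,
            l2ρ ρ (fun z => Matrix.vecMul z Φ ⬝ᵥ v) ≤
              Real.sqrt ((1 / (n : ℝ)) *
                  ∑ t ∈ Finset.range n, (Matrix.vecMul (x t ω) Φ ⬝ᵥ v) ^ 2) +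
                mmax * e2norm v *
                  (2 * ε + (c₁ / n * Real.log (c₂ * (3 / ε) ^ d / ξ)) ^ ((1 : ℝ) / 4))} := by
  classical
  have hM0 : 0 ≤ mmax := by
    rw [hmmax]
    refine Real.sSup_nonneg ?_
    rintro _ ⟨z, _, rfl⟩
    exact e2norm_nonneg_s12 _
  have hM (z : Fin D → ℝ) (hz : z ∈ Xset) : e2norm (Matrix.vecMul z Φ) ≤ mmax := by
    rw [hmmax]
    refine le_csSup ⟨Real.sqrt (∑ j, ∑ i, Φ i j ^ 2), ?_⟩ ⟨z, hz, rfl⟩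
    rintro _ ⟨y, hy, rfl⟩
    exact (e2norm_vecMul_le y Φ).trans
      (mul_le_of_le_one_left (Real.sqrt_nonneg _) (hXnorm y hy))
  obtain ⟨s, hs1, hnet, hcard⟩ :=
    exists_finset_net_sphere (E := EuclideanSpace ℝ (Fin d)) hε0 hε1
  rw [finrank_euclideanSpace_fin] at hcard
  have hN : 1 ≤ (3 / ε) ^ d := one_le_pow₀ ((one_le_div hε0).2 (by linarith))
  set ξ' : ℝ := ξ / (3 / ε) ^ d with hξ'
  have hξ'0 : 0 < ξ' := by positivity
  have hξ'1 : ξ' < 1 := (div_le_self hξ0.le hN).trans_lt hξ1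
  set L : ℝ := c₁ / n * Real.log (c₂ * (3 / ε) ^ d / ξ) with hL
  have hL' : c₁ / n * Real.log (c₂ / ξ') = L := by
    rw [hL, hξ', div_div_eq_mul_div]
  have hL0 : 0 ≤ L := by
    rw [← hL']
    refine mul_nonneg (by positivity) (Real.log_nonneg ?_)
    rw [le_div_iff₀ hξ'0]
    linarith
  have hcont (w : Fin d → ℝ) : Continuous fun z : Fin D → ℝ => Matrix.vecMul z Φ ⬝ᵥ w := by
    unfold Matrix.vecMul dotProduct; fun_prop
  let f (w : Fin d → ℝ) (z : Fin D → ℝ) : ℝ := min ((Matrix.vecMul z Φ ⬝ᵥ w) ^ 2) (mmax ^ 2)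
  have hfmeas (w : Fin d → ℝ) : Measurable (f w) :=
    (((hcont w).pow 2).min continuous_const).measurable
  have hfIcc (w : Fin d → ℝ) (z : Fin D → ℝ) : f w z ∈ Set.Icc 0 (mmax ^ 2) :=
    ⟨le_min (sq_nonneg _) (sq_nonneg _), min_le_right _ _⟩
  have hfeq (w : Fin d → ℝ) (hw : e2norm w = 1) (z : Fin D → ℝ) (hz : z ∈ Xset) :
      f w z = (Matrix.vecMul z Φ ⬝ᵥ w) ^ 2 := by
    refine min_eq_left (sq_le_sq.2 ?_)
    rw [abs_of_nonneg hM0]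
    calc _ ≤ e2norm (Matrix.vecMul z Φ) * e2norm w := abs_dotProduct_le_e2norm_mul _ _
      _ ≤ mmax := by rw [hw, mul_one]; exact hM z hz
  have hmean (w : Fin d → ℝ) :
      ∫ ω, (1 / (n : ℝ)) * ∑ t ∈ Finset.range n, f w (x t ω) ∂P = ∫ z, f w z ∂ρ := by
    have hint (t : ℕ) (ht : t ∈ Finset.range n) : ∫ ω, f w (x t ω) ∂P = ∫ z, f w z ∂ρ := by
      have ht := Finset.mem_range.1 ht
      rw [← hstat t ht, integral_map (hxmeas t ht).aemeasurable (hfmeas w).aestronglyMeasurable]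
    rw [integral_const_mul, integral_finsetSum, Finset.sum_congr rfl hint]
    · simp only [Finset.sum_const, Finset.card_range, nsmul_eq_mul]
      field_simp
    · intro t ht
      refine Integrable.of_bound
        ((hfmeas w).comp (hxmeas t (Finset.mem_range.1 ht))).aestronglyMeasurable (mmax ^ 2) ?_
      filter_upwards with ω
      rw [Real.norm_of_nonneg (hfIcc w _).1]
      exact (hfIcc w _).2
  let G (w : Fin d → ℝ) : Set Ω :=
    {ω | |(∫ ω', (1 / (n : ℝ)) * ∑ t ∈ Finset.range n, f w (x t ω') ∂P) -
      (1 / (n : ℝ)) * ∑ t ∈ Finset.range n, f w (x t ω)| ≤ mmax ^ 2 * Real.sqrt L}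
  have hGmeas (w : Fin d → ℝ) : MeasurableSet (G w) := by
    refine measurableSet_le (Measurable.abs (measurable_const.sub (measurable_const.mul ?_)))
      measurable_const
    exact Finset.measurable_sum _ fun t ht =>
      (hfmeas w).comp (hxmeas t (Finset.mem_range.1 ht))
  have hGprob (w : Fin d → ℝ) : P (G w)ᶜ ≤ ENNReal.ofReal ξ' := by
    have h := hConc (mmax ^ 2) (f w) (hfmeas w) (hfIcc w) ξ' hξ'0 hξ'1
    rw [hL'] at h
    rw [prob_compl_eq_one_sub (hGmeas w)]
    exact tsub_le_iff_tsub_le.1 h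
  have hunion : P (⋃ c ∈ s, (G c.ofLp)ᶜ) ≤ ENNReal.ofReal ξ :=
    calc P (⋃ c ∈ s, (G c.ofLp)ᶜ) ≤ ∑ c ∈ s, P (G c.ofLp)ᶜ := measure_biUnion_finset_le _ _
      _ ≤ ∑ _c ∈ s, ENNReal.ofReal ξ' := Finset.sum_le_sum fun c _ => hGprob c.ofLp
      _ = ENNReal.ofReal (s.card * ξ') := by
        rw [Finset.sum_const, nsmul_eq_mul, ENNReal.ofReal_mul (by positivity),
          ENNReal.ofReal_natCast]
      _ ≤ ENNReal.ofReal ξ := by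
        refine ENNReal.ofReal_le_ofReal ?_
        calc s.card * ξ' ≤ (3 / ε) ^ d * ξ' := mul_le_mul_of_nonneg_right hcard hξ'0.le
          _ = ξ := mul_div_cancel₀ _ (by positivity)
  have hgood : 1 - ENNReal.ofReal ξ ≤ P (⋃ c ∈ s, (G c.ofLp)ᶜ)ᶜ := by
    rw [prob_compl_eq_one_sub (Finset.measurableSet_biUnion _ fun c _ => (hGmeas c.ofLp).compl)]
    exact tsub_le_tsub_left hunion 1
  refine hgood.trans (measure_mono fun ω hω v => ?_)
  simp only [Set.compl_iUnion, compl_compl, Set.mem_iInter] at hω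
  have hprob := isProbabilityMeasure_empiricalMeasure hn fun t => x t ω
  have hemp (w : Fin d → ℝ) := l2ρ_empiricalMeasure n (fun t => x t ω) (hcont w).measurable
  have hMmeas : MeasurableSet {z : Fin D → ℝ | e2norm (Matrix.vecMul z Φ) ≤ mmax} := by
    refine measurableSet_le (Continuous.measurable ?_) measurable_const
    unfold e2norm Matrix.vecMul dotProduct
    fun_prop
  have hquarter : Real.sqrt (Real.sqrt L) = L ^ ((1 : ℝ) / 4) := by
    rw [Real.sqrt_eq_rpow, Real.sqrt_eq_rpow, ← Real.rpow_mul hL0]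
    norm_num
  have key := l2ρ_le_of_net (μ := ρ) (ν := empiricalMeasure n fun t => x t ω)
    (δ := mmax * L ^ ((1 : ℝ) / 4)) hM0
    (hρ.mono hM) (ae_empiricalMeasure n _ hMmeas fun t ht => hM _ (hxX t ht ω)) hε0.le s hnet
    (fun c hc => ?_) v
  · rw [hemp v] at key
    linarith
  · have hc1 : e2norm c.ofLp = 1 := by rw [e2norm_eq_norm]; exact hs1 c hc
    have h : |(∫ ω', (1 / (n : ℝ)) * ∑ t ∈ Finset.range n, f c.ofLp (x t ω') ∂P) -
        (1 / (n : ℝ)) * ∑ t ∈ Finset.range n, f c.ofLp (x t ω)| ≤ mmax ^ 2 * Real.sqrt L := hω c hc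
    rw [hmean, integral_congr_ae (hρ.mono (hfeq _ hc1)), Finset.sum_congr rfl fun t ht =>
      hfeq _ hc1 _ (hxX t (Finset.mem_range.1 ht) ω)] at h
    rw [hemp c.ofLp, l2ρ, ← hquarter]
    calc Real.sqrt (∫ z, (Matrix.vecMul z Φ ⬝ᵥ c.ofLp) ^ 2 ∂ρ)
        ≤ Real.sqrt ((1 / (n : ℝ)) * ∑ t ∈ Finset.range n,
            (Matrix.vecMul (x t ω) Φ ⬝ᵥ c.ofLp) ^ 2 + mmax ^ 2 * Real.sqrt L) :=
          Real.sqrt_le_sqrt (by linarith [(abs_le.1 h).2])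
      _ ≤ Real.sqrt ((1 / (n : ℝ)) * ∑ t ∈ Finset.range n,
            (Matrix.vecMul (x t ω) Φ ⬝ᵥ c.ofLp) ^ 2) + Real.sqrt (mmax ^ 2 * Real.sqrt L) :=
          sqrt_add_le_sqrt_add_sqrt (by positivity) (by positivity)
      _ = _ := by rw [Real.sqrt_mul (sq_nonneg _), Real.sqrt_sq hM0]

end
end
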